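/- arXiv:2207.03957 — 14 statements merged into one kernel-verified Lean document; each statement's English description precedes it below -/
import Mathlib

section
/- (PPM primal descent, Lemma 4.) Let G be μ_x-strongly convex and suppose −K^⊤y* ∈ ∂G(x*). Let η_x > 0, let x, x' ∈ E_x and y' ∈ E_y, and let g ∈ ∂G(x') be such that x' = x − η_x (g + K^⊤ y'). Then (1 + 2 μ_x η_x) (1/η_x) ‖x' − x*‖² ≤ (1/η_x) ‖x − x*‖² − (1/η_x) ‖x' − x‖² − 2 ⟨K^⊤ y' − K^⊤ y*, x' − x*⟩. -/
open RealInnerProductSpace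

/-- `g` is a subgradient of `f` at `u`: `f v ≥ f u + ⟨g, v - u⟩` for all `v`. -/
def IsSubgradientAt {E : Type*} [NormedAddCommGroup E] [InnerProductSpace ℝ E]
    (f : E → ℝ) (g u : E) : Prop :=
  ∀ v, f u + ⟪g, v - u⟫ ≤ f v

/-- `f` is `μ`-strongly convex in the subgradient sense. -/
def StronglyConvexSubgrad {E : Type*} [NormedAddCommGroup E] [InnerProductSpace ℝ E]
    (f : E → ℝ) (μ : ℝ) : Prop :=
  ∀ u v g, IsSubgradientAt f g u → f u + ⟪g, v - u⟫ + μ / 2 * ‖v - u‖ ^ 2 ≤ f v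

/-- PPM primal descent (Lemma 4). -/
theorem ppm_primal_descent
    {Ex Ey : Type*}
    [NormedAddCommGroup Ex] [InnerProductSpace ℝ Ex] [FiniteDimensional ℝ Ex]
    [NormedAddCommGroup Ey] [InnerProductSpace ℝ Ey] [FiniteDimensional ℝ Ey]
    (K : Ex →ₗ[ℝ] Ey) (Kt : Ey →ₗ[ℝ] Ex)
    (hadj : ∀ (x : Ex) (y : Ey), ⟪K x, y⟫ = ⟪x, Kt y⟫)
    (G : Ex → ℝ) (μx : ℝ) (hμx : 0 < μx)
    (hG : StronglyConvexSubgrad G μx)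
    (xstar : Ex) (ystar : Ey)
    (hopt : IsSubgradientAt G (-(Kt ystar)) xstar)
    (ηx : ℝ) (hηx : 0 < ηx)
    (x x' : Ex) (y' : Ey) (g : Ex)
    (hg : IsSubgradientAt G g x')
    (hupd : x' = x - ηx • (g + Kt y')) :
    (1 + 2 * μx * ηx) * (1 / ηx) * ‖x' - xstar‖ ^ 2 ≤
      (1 / ηx) * ‖x - xstar‖ ^ 2 - (1 / ηx) * ‖x' - x‖ ^ 2
        - 2 * ⟪Kt y' - Kt ystar, x' - xstar⟫ := by
  have h1 := hG x' xstar g hg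
  have h2 := hG xstar x' _ hopt
  obtain ⟨d, hd⟩ : ∃ d, d = x' - xstar := ⟨_, rfl⟩
  obtain ⟨w, hw⟩ : ∃ w, w = g + Kt y' := ⟨_, rfl⟩
  have e1 : xstar - x' = -d := by rw [hd]; abel
  have e2 : x' - x = -(ηx • w) := by rw [hupd, hw]; abel
  have e3 : x - xstar = d + ηx • w := by rw [hd, hupd, hw]; abel
  have e4 : g = w - Kt y' := by rw [hw]; abel
  rw [e1, norm_neg, inner_neg_right, e4, inner_sub_left] at h1
  rw [← hd, inner_neg_left] at h2
  rw [← hd, e2, e3, norm_neg, norm_add_sq_real, inner_smul_right, inner_sub_left,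
    real_inner_comm w d]
  have key : 1 / ηx * (‖d‖ ^ 2 + 2 * (ηx * ⟪w, d⟫) + ‖ηx • w‖ ^ 2) - 1 / ηx * ‖ηx • w‖ ^ 2
      = 1 / ηx * ‖d‖ ^ 2 + 2 * ⟪w, d⟫ := by
    field_simp
    ring
  have key2 : (1 + 2 * μx * ηx) * (1 / ηx) * ‖d‖ ^ 2
      = 1 / ηx * ‖d‖ ^ 2 + 2 * (μx * ‖d‖ ^ 2) := by
    field_simp
  rw [key2]
  have e5 := real_inner_comm w d
  simp only [e5] at *
  linarith
end

section
/- (PPM dual descent, Lemma 5.) Let F* be μ_y-strongly convex and suppose K x* ∈ ∂F*(y*). Let η_y > 0, let y, y' ∈ E_y and x' ∈ E_x, and let h ∈ ∂F*(y') be such that y' = y − η_y (h − K x'). Then (1 + 2 μ_y η_y) (1/η_y) ‖y' − y*‖² ≤ (1/η_y) ‖y − y*‖² − (1/η_y) ‖y' − y‖² + 2 ⟨K^⊤ y' − K^⊤ y*, x' − x*⟩. -/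
open RealInnerProductSpace

/-- PPM dual descent (Lemma 5). -/
theorem ppm_dual_descent
    {Ex Ey : Type*}
    [NormedAddCommGroup Ex] [InnerProductSpace ℝ Ex] [FiniteDimensional ℝ Ex]
    [NormedAddCommGroup Ey] [InnerProductSpace ℝ Ey] [FiniteDimensional ℝ Ey]
    (K : Ex →ₗ[ℝ] Ey) (Kt : Ey →ₗ[ℝ] Ex)
    (hadj : ∀ (x : Ex) (y : Ey), ⟪K x, y⟫ = ⟪x, Kt y⟫)
    (Fs : Ey → ℝ) (μy : ℝ) (hμy : 0 < μy)
    (hFs : StronglyConvexSubgrad Fs μy)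
    (xstar : Ex) (ystar : Ey)
    (hopt : IsSubgradientAt Fs (K xstar) ystar)
    (ηy : ℝ) (hηy : 0 < ηy)
    (y y' : Ey) (x' : Ex) (h : Ey)
    (hh : IsSubgradientAt Fs h y')
    (hupd : y' = y - ηy • (h - K x')) :
    (1 + 2 * μy * ηy) * (1 / ηy) * ‖y' - ystar‖ ^ 2 ≤
      (1 / ηy) * ‖y - ystar‖ ^ 2 - (1 / ηy) * ‖y' - y‖ ^ 2
        + 2 * ⟪Kt y' - Kt ystar, x' - xstar⟫ := by
  have h1 := hFs y' ystar h hh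
  have h2 := hFs ystar y' (K xstar) hopt
  obtain ⟨d, hd⟩ : ∃ d, d = y' - ystar := ⟨_, rfl⟩
  obtain ⟨w, hw⟩ : ∃ w, w = h - K x' := ⟨_, rfl⟩
  have e1 : y - ystar = d + ηy • w := by rw [hd, hupd, hw]; abel
  have e2 : y' - y = -(ηy • w) := by rw [hupd, hw]; abel
  have e3 : ystar - y' = -d := by rw [hd]; abel
  have e4 : ⟪Kt y' - Kt ystar, x' - xstar⟫ = ⟪K x', d⟫ - ⟪K xstar, d⟫ := by
    rw [← map_sub, ← hd, real_inner_comm, ← hadj, map_sub, inner_sub_left]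
  have e5 : ⟪d, w⟫ = ⟪h, d⟫ - ⟪K x', d⟫ := by
    rw [real_inner_comm, hw, inner_sub_left]
  rw [e3, inner_neg_right, norm_neg] at h1
  rw [← hd] at h2
  rw [← hd, e1, e2, e4, norm_neg, norm_add_sq_real, inner_smul_right, e5]
  have e6 : (1 + 2 * μy * ηy) * (1 / ηy) * ‖d‖ ^ 2 = 1 / ηy * ‖d‖ ^ 2 + 2 * μy * ‖d‖ ^ 2 := by
    field_simp
  have e7 : ∀ a b c : ℝ, 1 / ηy * (a + 2 * (ηy * b) + c) - 1 / ηy * c = 1 / ηy * a + 2 * b := by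
    intro a b c
    field_simp
    ring
  rw [e6, e7]
  linarith
end

section
/- (Convergence of the Proximal-Point Method, Theorem 9, contraction.) Let G be μ_x-strongly convex, F* be μ_y-strongly convex, and (x*, y*) satisfy −K^⊤y* ∈ ∂G(x*) and K x* ∈ ∂F*(y*). Let η_x, η_y > 0 and let sequences (x^k), (y^k) together with subgradients g^k ∈ ∂G(x^{k+1}) and h^k ∈ ∂F*(y^{k+1}) satisfy, for all k ≥ 0, x^{k+1} = x^k − η_x (g^k + K^⊤ y^{k+1}) and y^{k+1} = y^k − η_y (h^k − K x^{k+1}). Define Δ^k := (1/η_x)‖x^k − x*‖² + (1/η_y)‖y^k − y*‖². Then for all k ≥ 0, Δ^{k+1} ≤ Δ^k / min{1 + 2 μ_x η_x, 1 + 2 μ_y η_y}. -/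
open RealInnerProductSpace

theorem strong_mono_aux {E : Type*} [NormedAddCommGroup E] [InnerProductSpace ℝ E]
    {f : E → ℝ} {μ : ℝ} (hf : StronglyConvexSubgrad f μ) {u v g g' : E}
    (hg : IsSubgradientAt f g u) (hg' : IsSubgradientAt f g' v) :
    μ * ‖u - v‖ ^ 2 ≤ ⟪g - g', u - v⟫ := by
  have h1 := hf u v g hg
  have h2 := hf v u g' hg'
  rw [norm_sub_rev v u, ← neg_sub u v, inner_neg_right] at h1
  rw [inner_sub_left]
  linarith

theorem step_aux {E : Type*} [NormedAddCommGroup E] [InnerProductSpace ℝ E]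
    {η : ℝ} (hη : 0 < η) {u v p s : E} (h : v = u - η • p) :
    (1 / η) * ‖v - s‖ ^ 2 + 2 * ⟪p, v - s⟫ ≤ (1 / η) * ‖u - s‖ ^ 2 := by
  have e : u - s = (v - s) + η • p := by rw [h]; abel
  rw [e, norm_add_sq_real, inner_smul_right, real_inner_comm (v - s) p]
  have : (1 / η) * (‖v - s‖ ^ 2 + 2 * (η * ⟪v - s, p⟫) + ‖η • p‖ ^ 2)
    = (1 / η) * ‖v - s‖ ^ 2 + 2 * ⟪v - s, p⟫ + (1 / η) * ‖η • p‖ ^ 2 := by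
    field_simp
  have h0 : 0 ≤ (1 / η) * ‖η • p‖ ^ 2 := by positivity
  have c := real_inner_comm (v - s) p
  linarith

/-- Convergence of the Proximal-Point Method (Theorem 9, contraction). -/
theorem ppm_contraction
    {Ex Ey : Type*}
    [NormedAddCommGroup Ex] [InnerProductSpace ℝ Ex] [FiniteDimensional ℝ Ex]
    [NormedAddCommGroup Ey] [InnerProductSpace ℝ Ey] [FiniteDimensional ℝ Ey]
    (K : Ex →ₗ[ℝ] Ey) (Kt : Ey →ₗ[ℝ] Ex)
    (hadj : ∀ (x : Ex) (y : Ey), ⟪K x, y⟫ = ⟪x, Kt y⟫)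
    (G : Ex → ℝ) (μx : ℝ) (hμx : 0 < μx) (hG : StronglyConvexSubgrad G μx)
    (Fs : Ey → ℝ) (μy : ℝ) (hμy : 0 < μy) (hFs : StronglyConvexSubgrad Fs μy)
    (xstar : Ex) (ystar : Ey)
    (hoptx : IsSubgradientAt G (-(Kt ystar)) xstar)
    (hopty : IsSubgradientAt Fs (K xstar) ystar)
    (ηx ηy : ℝ) (hηx : 0 < ηx) (hηy : 0 < ηy)
    (x : ℕ → Ex) (y : ℕ → Ey) (g : ℕ → Ex) (h : ℕ → Ey)
    (hg : ∀ k, IsSubgradientAt G (g k) (x (k + 1)))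
    (hh : ∀ k, IsSubgradientAt Fs (h k) (y (k + 1)))
    (hxupd : ∀ k, x (k + 1) = x k - ηx • (g k + Kt (y (k + 1))))
    (hyupd : ∀ k, y (k + 1) = y k - ηy • (h k - K (x (k + 1))))
    (Δ : ℕ → ℝ)
    (hΔ : ∀ k, Δ k = (1 / ηx) * ‖x k - xstar‖ ^ 2 + (1 / ηy) * ‖y k - ystar‖ ^ 2) :
    ∀ k, Δ (k + 1) ≤ Δ k / min (1 + 2 * μx * ηx) (1 + 2 * μy * ηy) := by
  intro k
  have hx := strong_mono_aux hG (hg k) hoptx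
  have hy := strong_mono_aux hFs (hh k) hopty
  have sx := step_aux (s := xstar) hηx (hxupd k)
  have sy := step_aux (s := ystar) hηy (hyupd k)
  have key : ⟪g k + Kt (y (k + 1)), x (k + 1) - xstar⟫ + ⟪h k - K (x (k + 1)), y (k + 1) - ystar⟫
      = ⟪g k - -(Kt ystar), x (k + 1) - xstar⟫ + ⟪h k - K xstar, y (k + 1) - ystar⟫ := by
    have e := hadj (x (k + 1) - xstar) (y (k + 1) - ystar)
    rw [real_inner_comm] at e
    rw [real_inner_comm, map_sub, map_sub] at e
    have e1 : g k + Kt (y (k + 1)) = (g k - -(Kt ystar)) + (Kt (y (k + 1)) - Kt ystar) := by abel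
    have e2 : h k - K (x (k + 1)) = (h k - K xstar) - (K (x (k + 1)) - K xstar) := by abel
    rw [e1, e2, inner_add_left, inner_sub_left (h k - K xstar)]
    have c := real_inner_comm (x (k + 1) - xstar) (Kt (y (k + 1)) - Kt ystar)
    have d := real_inner_comm (y (k + 1) - ystar) (K (x (k + 1)) - K xstar)
    linarith
  have hm : 0 < min (1 + 2 * μx * ηx) (1 + 2 * μy * ηy) := by
    apply lt_min <;> positivity
  rw [le_div_iff₀ hm, hΔ, hΔ]
  have ax : (1 / ηx) * ‖x (k + 1) - xstar‖ ^ 2 * min (1 + 2 * μx * ηx) (1 + 2 * μy * ηy)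
      ≤ (1 / ηx) * ‖x (k + 1) - xstar‖ ^ 2 * (1 + 2 * μx * ηx) :=
    mul_le_mul_of_nonneg_left (min_le_left _ _) (by positivity)
  have ay : (1 / ηy) * ‖y (k + 1) - ystar‖ ^ 2 * min (1 + 2 * μx * ηx) (1 + 2 * μy * ηy)
      ≤ (1 / ηy) * ‖y (k + 1) - ystar‖ ^ 2 * (1 + 2 * μy * ηy) :=
    mul_le_mul_of_nonneg_left (min_le_right _ _) (by positivity)
  have bx : (1 / ηx) * ‖x (k + 1) - xstar‖ ^ 2 * (1 + 2 * μx * ηx)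
      = (1 / ηx) * ‖x (k + 1) - xstar‖ ^ 2 + 2 * (μx * ‖x (k + 1) - xstar‖ ^ 2) := by
    field_simp
  have byy : (1 / ηy) * ‖y (k + 1) - ystar‖ ^ 2 * (1 + 2 * μy * ηy)
      = (1 / ηy) * ‖y (k + 1) - ystar‖ ^ 2 + 2 * (μy * ‖y (k + 1) - ystar‖ ^ 2) := by
    field_simp
  rw [add_mul]
  linarith
end

section
/- (Chambolle–Pock primal descent, Lemma 10.) Let G be μ_x-strongly convex and suppose −K^⊤y* ∈ ∂G(x*). Let η_x > 0, let x, x' ∈ E_x and ȳ ∈ E_y, and let g ∈ ∂G(x') be such that x' = x − η_x (g + K^⊤ ȳ). Then (1 + 2 μ_x η_x) (1/η_x) ‖x' − x*‖² ≤ (1/η_x) ‖x − x*‖² − (1/η_x) ‖x' − x‖² − 2 ⟨K^⊤ ȳ − K^⊤ y*, x' − x*⟩. -/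
open RealInnerProductSpace

/-- Chambolle–Pock primal descent (Lemma 10). -/
theorem cp_primal_descent
    {Ex Ey : Type*}
    [NormedAddCommGroup Ex] [InnerProductSpace ℝ Ex] [FiniteDimensional ℝ Ex]
    [NormedAddCommGroup Ey] [InnerProductSpace ℝ Ey] [FiniteDimensional ℝ Ey]
    (K : Ex →ₗ[ℝ] Ey) (Kt : Ey →ₗ[ℝ] Ex)
    (hadj : ∀ (x : Ex) (y : Ey), ⟪K x, y⟫ = ⟪x, Kt y⟫)
    (G : Ex → ℝ) (μx : ℝ) (hμx : 0 < μx)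
    (hG : StronglyConvexSubgrad G μx)
    (xstar : Ex) (ystar : Ey)
    (hopt : IsSubgradientAt G (-(Kt ystar)) xstar)
    (ηx : ℝ) (hηx : 0 < ηx)
    (x x' : Ex) (ybar : Ey) (g : Ex)
    (hg : IsSubgradientAt G g x')
    (hupd : x' = x - ηx • (g + Kt ybar)) :
    (1 + 2 * μx * ηx) * (1 / ηx) * ‖x' - xstar‖ ^ 2 ≤
      (1 / ηx) * ‖x - xstar‖ ^ 2 - (1 / ηx) * ‖x' - x‖ ^ 2
        - 2 * ⟪Kt ybar - Kt ystar, x' - xstar⟫ := by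
  have h1 := hG x' xstar g hg
  have h2 := hG xstar x' _ hopt
  obtain ⟨d, hd⟩ : ∃ d, d = x' - xstar := ⟨_, rfl⟩
  have e1 : xstar - x' = -d := by rw [hd]; abel
  have e2 : x' - x = -(ηx • (g + Kt ybar)) := by rw [hupd]; abel
  have e3 : x - xstar = d + ηx • (g + Kt ybar) := by
    have : x = x' + ηx • (g + Kt ybar) := by rw [hupd]; abel
    rw [hd]; nth_rewrite 1 [this]; abel
  rw [e1, inner_neg_right, norm_neg] at h1
  rw [← hd, inner_neg_left] at h2
  rw [e2, e3, ← hd, norm_neg, norm_add_sq_real, inner_smul_right, real_inner_comm,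
    inner_add_left, inner_sub_left]
  have key : μx * ‖d‖ ^ 2 ≤ ⟪g, d⟫ + ⟪Kt ystar, d⟫ := by linarith
  have hL : (1 + 2 * μx * ηx) * (1 / ηx) * ‖d‖ ^ 2
      = 1 / ηx * ‖d‖ ^ 2 + 2 * (μx * ‖d‖ ^ 2) := by
    field_simp
  have hR : 1 / ηx * (‖d‖ ^ 2 + 2 * (ηx * (⟪g, d⟫ + ⟪Kt ybar, d⟫))
        + ‖ηx • (g + Kt ybar)‖ ^ 2)
      = 1 / ηx * ‖d‖ ^ 2 + 2 * (⟪g, d⟫ + ⟪Kt ybar, d⟫)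
        + 1 / ηx * ‖ηx • (g + Kt ybar)‖ ^ 2 := by
    field_simp
  rw [hL, hR]
  linarith
end

section
/- (Complexity of the Chambolle–Pock method with θ = 0, Theorem 11.) Let G be μ_x-strongly convex, F* be μ_y-strongly convex, let L_xy > 0 satisfy ‖K x‖ ≤ L_xy‖x‖ for all x, and let (x*, y*) satisfy −K^⊤y* ∈ ∂G(x*) and K x* ∈ ∂F*(y*). Set η_x = μ_y / L_xy² and η_y = μ_x / L_xy². Let sequences (x^k), (y^k) together with subgradients g^k ∈ ∂G(x^{k+1}) and h^k ∈ ∂F*(y^{k+1}) satisfy, for all k ≥ 0, x^{k+1} = x^k − η_x (g^k + K^⊤ y^k) and y^{k+1} = y^k − η_y (h^k − K x^{k+1}). Define Δ^k := (1/η_x)‖x^k − x*‖² + (1/η_y)‖y^k − y*‖². Then for all k ≥ 0, Δ^{k+1} ≤ Δ^k / (1 + μ_x μ_y / L_xy²). -/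
open RealInnerProductSpace

/-- Complexity of the Chambolle–Pock method with `θ = 0` (Theorem 11). -/
theorem cp_theta_zero_contraction
    {Ex Ey : Type*}
    [NormedAddCommGroup Ex] [InnerProductSpace ℝ Ex] [FiniteDimensional ℝ Ex]
    [NormedAddCommGroup Ey] [InnerProductSpace ℝ Ey] [FiniteDimensional ℝ Ey]
    (K : Ex →ₗ[ℝ] Ey) (Kt : Ey →ₗ[ℝ] Ex)
    (hadj : ∀ (x : Ex) (y : Ey), ⟪K x, y⟫ = ⟪x, Kt y⟫)
    (Lxy : ℝ) (hLxy : 0 < Lxy) (hK : ∀ x : Ex, ‖K x‖ ≤ Lxy * ‖x‖)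
    (G : Ex → ℝ) (μx : ℝ) (hμx : 0 < μx) (hG : StronglyConvexSubgrad G μx)
    (Fs : Ey → ℝ) (μy : ℝ) (hμy : 0 < μy) (hFs : StronglyConvexSubgrad Fs μy)
    (xstar : Ex) (ystar : Ey)
    (hoptx : IsSubgradientAt G (-(Kt ystar)) xstar)
    (hopty : IsSubgradientAt Fs (K xstar) ystar)
    (ηx ηy : ℝ)
    (hηx : ηx = μy / Lxy ^ 2) (hηy : ηy = μx / Lxy ^ 2)
    (x : ℕ → Ex) (y : ℕ → Ey) (g : ℕ → Ex) (h : ℕ → Ey)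
    (hg : ∀ k, IsSubgradientAt G (g k) (x (k + 1)))
    (hh : ∀ k, IsSubgradientAt Fs (h k) (y (k + 1)))
    (hxupd : ∀ k, x (k + 1) = x k - ηx • (g k + Kt (y k)))
    (hyupd : ∀ k, y (k + 1) = y k - ηy • (h k - K (x (k + 1))))
    (Δ : ℕ → ℝ)
    (hΔ : ∀ k, Δ k = (1 / ηx) * ‖x k - xstar‖ ^ 2 + (1 / ηy) * ‖y k - ystar‖ ^ 2) :
    ∀ k, Δ (k + 1) ≤ Δ k / (1 + μx * μy / Lxy ^ 2) := by
  intro k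
  have hL2 : 0 < Lxy ^ 2 := by positivity
  have hex : 0 < ηx := by rw [hηx]; positivity
  have hey : 0 < ηy := by rw [hηy]; positivity
  have e1 : ηx * Lxy ^ 2 = μy := by rw [hηx]; field_simp
  have e2 : ηy * Lxy ^ 2 = μx := by rw [hηy]; field_simp
  -- strong monotonicity
  have m1 : μx * ‖x (k+1) - xstar‖ ^ 2 ≤ ⟪g k + Kt ystar, x (k+1) - xstar⟫ := by
    have p := hG _ xstar _ (hg k)
    have q := hG _ (x (k+1)) _ hoptx
    rw [← neg_sub (x (k+1)) xstar, norm_neg, inner_neg_right] at p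
    rw [inner_neg_left] at q
    rw [inner_add_left]
    linarith
  have m2 : μy * ‖y (k+1) - ystar‖ ^ 2 ≤ ⟪h k - K xstar, y (k+1) - ystar⟫ := by
    have p := hFs _ ystar _ (hh k)
    have q := hFs _ (y (k+1)) _ hopty
    rw [← neg_sub (y (k+1)) ystar, norm_neg, inner_neg_right] at p
    rw [inner_sub_left]
    linarith
  obtain ⟨a, ha⟩ : ∃ a, a = x (k+1) - xstar := ⟨_, rfl⟩
  obtain ⟨b, hb⟩ : ∃ b, b = y (k+1) - ystar := ⟨_, rfl⟩
  obtain ⟨d, hd⟩ : ∃ d, d = g k + Kt (y k) := ⟨_, rfl⟩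
  obtain ⟨e, he⟩ : ∃ e, e = h k - K (x (k+1)) := ⟨_, rfl⟩
  have a0 : x k - xstar = a + ηx • d := by rw [ha, hd, hxupd k]; abel
  have b0 : y k - ystar = b + ηy • e := by rw [hb, he, hyupd k]; abel
  have d1 : g k + Kt ystar = d - Kt b - ηy • Kt e := by
    have : Kt (y k - ystar) = Kt b + ηy • Kt e := by rw [b0]; simp
    rw [map_sub] at this
    rw [hd, sub_sub, ← this]; abel
  have d2 : h k - K xstar = e + K a := by rw [he, ha, map_sub]; abel
  rw [← ha, d1, inner_sub_left, inner_sub_left, inner_smul_left] at m1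
  rw [← hb, d2, inner_add_left] at m2
  have i1 : ⟪Kt b, a⟫ = ⟪K a, b⟫ := by rw [hadj, real_inner_comm]
  have i2 : ⟪Kt e, a⟫ = ⟪K a, e⟫ := by rw [hadj, real_inner_comm]
  rw [i1, i2] at m1
  simp only [conj_trivial] at m1
  have cs : -⟪K a, e⟫ ≤ Lxy * ‖a‖ * ‖e‖ := by
    have := abs_real_inner_le_norm (K a) e
    have h1 := neg_abs_le ⟪K a, e⟫
    have h2 := mul_le_mul_of_nonneg_right (hK a) (norm_nonneg e)
    linarith
  have n1 : ‖a + ηx • d‖ ^ 2 = ‖a‖ ^ 2 + 2 * ηx * ⟪d, a⟫ + ηx ^ 2 * ‖d‖ ^ 2 := by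
    rw [norm_add_sq_real, inner_smul_right, norm_smul, real_inner_comm, mul_pow, Real.norm_eq_abs,
      sq_abs]; ring
  have n2 : ‖b + ηy • e‖ ^ 2 = ‖b‖ ^ 2 + 2 * ηy * ⟪e, b⟫ + ηy ^ 2 * ‖e‖ ^ 2 := by
    rw [norm_add_sq_real, inner_smul_right, norm_smul, real_inner_comm, mul_pow, Real.norm_eq_abs,
      sq_abs]; ring
  have D0 : Δ k = 1 / ηx * ‖a‖ ^ 2 + 1 / ηy * ‖b‖ ^ 2 + 2 * ⟪d, a⟫ + 2 * ⟪e, b⟫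
      + ηx * ‖d‖ ^ 2 + ηy * ‖e‖ ^ 2 := by
    rw [hΔ, a0, b0, n1, n2]; field_simp; ring
  have D1 : Δ (k+1) * (1 + μx * μy / Lxy ^ 2)
      = 1 / ηx * ‖a‖ ^ 2 + 1 / ηy * ‖b‖ ^ 2 + μx * ‖a‖ ^ 2 + μy * ‖b‖ ^ 2 := by
    rw [hΔ, ← ha, ← hb, hηx, hηy]; field_simp; ring
  rw [le_div_iff₀ (by positivity), D1, D0]
  have t1 : 0 ≤ ηx * ‖d‖ ^ 2 := by positivity
  have t2 : 0 ≤ μy * ‖b‖ ^ 2 := by positivity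
  have t3 : 0 ≤ ηy * (‖e‖ - Lxy * ‖a‖) ^ 2 := by positivity
  have t4 := mul_le_mul_of_nonneg_left cs hey.le
  have t5 : μx * ‖a‖ ^ 2 = ηy * Lxy ^ 2 * ‖a‖ ^ 2 := by rw [e2]
  nlinarith
end

section
/- (Complexity of the Chambolle–Pock method with extrapolation, Theorem 13.) Let G be μ_x-strongly convex, F* be μ_y-strongly convex, let L_xy > 0 satisfy ‖K x‖ ≤ L_xy‖x‖ for all x, and let (x*, y*) satisfy −K^⊤y* ∈ ∂G(x*) and K x* ∈ ∂F*(y*). Set η_x = (1/L_xy)√(μ_y/μ_x), η_y = (1/L_xy)√(μ_x/μ_y), and θ = max{1/(1 + 2μ_xη_x), 1/(1 + 2μ_yη_y)}. Let sequences (x^k), (y^k), (ȳ^k) together with subgradients g^k ∈ ∂G(x^{k+1}) and h^k ∈ ∂F*(y^{k+1}) satisfy, for all k ≥ 0: x^{k+1} = x^k − η_x (g^k + K^⊤ ȳ^k); y^{k+1} = y^k − η_y (h^k − K x^{k+1}); ȳ^0 = y^0; and ȳ^{k+1} = y^{k+1} + θ (y^{k+1} − y^k). Define, for k ≥ 0,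 Δ^{k+1} := (1+2μ_xη_x)(1/η_x)‖x^{k+1} − x*‖² + (1+2μ_yη_y)(1/η_y)‖y^{k+1} − y*‖² + (1/η_y)‖y^{k+1} − y^k‖² − 2⟨K^⊤ y^{k+1} − K^⊤ y^k, x^{k+1} − x*⟩, and Δ^0 := (1+2μ_xη_x)(1/η_x)‖x^0 − x*‖² + (1+2μ_yη_y)(1/η_y)‖y^0 − y*‖². Then for all k ≥ 0, 0 ≤ Δ^k ≤ θ^k Δ^0. -/
open RealInnerProductSpace

theorem mono_aux {E : Type*} [NormedAddCommGroup E] [InnerProductSpace ℝ E]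
    {f : E → ℝ} {μ : ℝ} (hf : StronglyConvexSubgrad f μ) {u v p q : E}
    (hp : IsSubgradientAt f p u) (hq : IsSubgradientAt f q v) :
    μ * ‖u - v‖ ^ 2 ≤ ⟪p - q, u - v⟫ := by
  have h1 := hf u v p hp
  have h2 := hf v u q hq
  have e : v - u = -(u - v) := by abel
  rw [e, inner_neg_right, norm_neg] at h1
  rw [inner_sub_left]
  linarith

theorem prox_aux {E : Type*} [NormedAddCommGroup E] [InnerProductSpace ℝ E]
    {η μ : ℝ} (hη : 0 < η) (X Xp w : E) (h : μ * ‖X‖ ^ 2 ≤ ⟪w, X⟫ + (1 / η) * ⟪Xp - X, X⟫) :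
    (1 + 2 * μ * η) * (1 / η) * ‖X‖ ^ 2 + (1 / η) * ‖X - Xp‖ ^ 2
      ≤ (1 / η) * ‖Xp‖ ^ 2 + 2 * ⟪w, X⟫ := by
  have e : ‖X - Xp‖ ^ 2 = ‖Xp‖ ^ 2 - ‖X‖ ^ 2 - 2 * ⟪Xp - X, X⟫ := by
    rw [norm_sub_sq_real, inner_sub_left, real_inner_self_eq_norm_sq, real_inner_comm]
    ring
  have e2 : (1 + 2 * μ * η) * (1 / η) = 1 / η + 2 * μ := by field_simp
  rw [e, e2]
  nlinarith

/-- Complexity of the Chambolle–Pock method with extrapolation (Theorem 13). -/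
theorem cp_extrapolation_convergence
    {Ex Ey : Type*}
    [NormedAddCommGroup Ex] [InnerProductSpace ℝ Ex] [FiniteDimensional ℝ Ex]
    [NormedAddCommGroup Ey] [InnerProductSpace ℝ Ey] [FiniteDimensional ℝ Ey]
    (K : Ex →ₗ[ℝ] Ey) (Kt : Ey →ₗ[ℝ] Ex)
    (hadj : ∀ (x : Ex) (y : Ey), ⟪K x, y⟫ = ⟪x, Kt y⟫)
    (Lxy : ℝ) (hLxy : 0 < Lxy) (hK : ∀ x : Ex, ‖K x‖ ≤ Lxy * ‖x‖)
    (G : Ex → ℝ) (μx : ℝ) (hμx : 0 < μx) (hG : StronglyConvexSubgrad G μx)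
    (Fs : Ey → ℝ) (μy : ℝ) (hμy : 0 < μy) (hFs : StronglyConvexSubgrad Fs μy)
    (xstar : Ex) (ystar : Ey)
    (hoptx : IsSubgradientAt G (-(Kt ystar)) xstar)
    (hopty : IsSubgradientAt Fs (K xstar) ystar)
    (ηx ηy θ : ℝ)
    (hηx : ηx = (1 / Lxy) * Real.sqrt (μy / μx))
    (hηy : ηy = (1 / Lxy) * Real.sqrt (μx / μy))
    (hθ : θ = max (1 / (1 + 2 * μx * ηx)) (1 / (1 + 2 * μy * ηy)))
    (x : ℕ → Ex) (y ybar : ℕ → Ey) (g : ℕ → Ex) (h : ℕ → Ey)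
    (hg : ∀ k, IsSubgradientAt G (g k) (x (k + 1)))
    (hh : ∀ k, IsSubgradientAt Fs (h k) (y (k + 1)))
    (hxupd : ∀ k, x (k + 1) = x k - ηx • (g k + Kt (ybar k)))
    (hyupd : ∀ k, y (k + 1) = y k - ηy • (h k - K (x (k + 1))))
    (hybar0 : ybar 0 = y 0)
    (hybarupd : ∀ k, ybar (k + 1) = y (k + 1) + θ • (y (k + 1) - y k))
    (Δ : ℕ → ℝ)
    (hΔ0 : Δ 0 = (1 + 2 * μx * ηx) * (1 / ηx) * ‖x 0 - xstar‖ ^ 2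
        + (1 + 2 * μy * ηy) * (1 / ηy) * ‖y 0 - ystar‖ ^ 2)
    (hΔ : ∀ k, Δ (k + 1) =
        (1 + 2 * μx * ηx) * (1 / ηx) * ‖x (k + 1) - xstar‖ ^ 2
        + (1 + 2 * μy * ηy) * (1 / ηy) * ‖y (k + 1) - ystar‖ ^ 2
        + (1 / ηy) * ‖y (k + 1) - y k‖ ^ 2
        - 2 * ⟪Kt (y (k + 1)) - Kt (y k), x (k + 1) - xstar⟫) :
    ∀ k, 0 ≤ Δ k ∧ Δ k ≤ θ ^ k * Δ 0 := by
  have hηx0 : 0 < ηx := by rw [hηx]; positivity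
  have hηy0 : 0 < ηy := by rw [hηy]; positivity
  have hηη : (1 / ηx) * (1 / ηy) = Lxy ^ 2 := by
    have : Real.sqrt (μy / μx) * Real.sqrt (μx / μy) = 1 := by
      rw [← Real.sqrt_mul (by positivity)]
      have : μy / μx * (μx / μy) = 1 := by field_simp
      rw [this, Real.sqrt_one]
    have h2 : ηx * ηy = 1 / Lxy ^ 2 := by
      rw [hηx, hηy]
      calc _ = (1 / Lxy) * (1 / Lxy) * (Real.sqrt (μy / μx) * Real.sqrt (μx / μy)) := by ring
        _ = _ := by rw [this]; field_simp
    rw [one_div_mul_one_div, h2]; simp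
  have hs : μx * ηx = μy * ηy := by
    have h3 : Real.sqrt (μy / μx) * μx = Real.sqrt (μx / μy) * μy := by
      rw [Real.sqrt_div hμy.le, Real.sqrt_div hμx.le]
      have hx := Real.sq_sqrt hμx.le
      have hy := Real.sq_sqrt hμy.le
      have : 0 < Real.sqrt μx := by positivity
      have : 0 < Real.sqrt μy := by positivity
      rw [div_mul_eq_mul_div, div_mul_eq_mul_div, div_eq_div_iff (by positivity) (by positivity)]
      nlinarith
    rw [hηx, hηy]
    linear_combination (1 / Lxy) * h3
  have hs' : 2 * μx * ηx = 2 * μy * ηy := by linarith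
  have hspos : 0 < μx * ηx := by positivity
  have hθx : θ * (1 + 2 * μx * ηx) = 1 := by
    rw [hθ, ← hs', max_self]
    exact one_div_mul_cancel (by nlinarith)
  have hθy : θ * (1 + 2 * μy * ηy) = 1 := by rw [← hs']; exact hθx
  have hθ0 : 0 < θ := by
    by_contra hc
    nlinarith
  have hθ1 : θ ≤ 1 := by nlinarith
  have ha : 0 < 1 / ηx := by positivity
  have hb : 0 < 1 / ηy := by positivity
  have cross : ∀ (u : Ey) (v : Ex),
      2 * ⟪Kt u, v⟫ ≤ (1 / ηy) * ‖u‖ ^ 2 + (1 / ηx) * ‖v‖ ^ 2 := by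
    intro u v
    have h1 : ⟪Kt u, v⟫ ≤ Lxy * ‖v‖ * ‖u‖ := by
      rw [real_inner_comm, ← hadj]
      exact (real_inner_le_norm _ _).trans (mul_le_mul_of_nonneg_right (hK v) (norm_nonneg _))
    have h2 : 0 ≤ (1 / ηx) * ((1 / ηy) * ‖u‖ ^ 2 + (1 / ηx) * ‖v‖ ^ 2 - 2 * (Lxy * ‖v‖ * ‖u‖)) := by
      have : (1 / ηx) * ((1 / ηy) * ‖u‖ ^ 2 + (1 / ηx) * ‖v‖ ^ 2 - 2 * (Lxy * ‖v‖ * ‖u‖))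
        = ((1 / ηx) * ‖v‖ - Lxy * ‖u‖) ^ 2 := by
        linear_combination ‖u‖ ^ 2 * hηη
      rw [this]; positivity
    have h3 := nonneg_of_mul_nonneg_right h2 ha
    linarith
  -- one step
  have step : ∀ (k : ℕ) (d : Ey), ybar k = y k + θ • d →
      Δ (k + 1) ≤ θ * ((1 + 2 * μx * ηx) * (1 / ηx) * ‖x k - xstar‖ ^ 2
        + (1 + 2 * μy * ηy) * (1 / ηy) * ‖y k - ystar‖ ^ 2
        + (1 / ηy) * ‖d‖ ^ 2 - 2 * ⟪Kt d, x k - xstar⟫) := by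
    intro k d hd
    have m1 := mono_aux hG (hg k) hoptx
    have m2 := mono_aux hFs (hh k) hopty
    have eg : g k = (1 / ηx) • (x k - x (k + 1)) - Kt (ybar k) := by
      rw [hxupd k, sub_sub_cancel, smul_smul, one_div_mul_cancel hηx0.ne', one_smul]; abel
    have eh : h k = (1 / ηy) • (y k - y (k + 1)) + K (x (k + 1)) := by
      have : y k - y (k + 1) = ηy • (h k - K (x (k + 1))) := by rw [hyupd k]; abel
      rw [this, smul_smul, one_div_mul_cancel hηy0.ne', one_smul]; abel
    have eg' : g k - -(Kt ystar) = Kt (ystar - ybar k)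
        + (1 / ηx) • ((x k - xstar) - (x (k + 1) - xstar)) := by
      rw [eg, map_sub, sub_sub_sub_cancel_right]; abel
    have eh' : h k - K xstar = K (x (k + 1) - xstar)
        + (1 / ηy) • ((y k - ystar) - (y (k + 1) - ystar)) := by
      rw [eh, map_sub, sub_sub_sub_cancel_right]; abel
    rw [eg', inner_add_left, real_inner_smul_left] at m1
    rw [eh', inner_add_left, real_inner_smul_left] at m2
    have p1 := prox_aux hηx0 _ _ _ m1
    have p2 := prox_aux hηy0 _ _ _ m2
    rw [sub_sub_sub_cancel_right] at p1 p2
    rw [hadj, real_inner_comm] at p2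
    have c := cross (-d) (x (k + 1) - x k)
    rw [map_neg, inner_neg_left, norm_neg] at c
    have ex : x (k + 1) - x k = (x (k + 1) - xstar) - (x k - xstar) := by abel
    have e1 : ⟪Kt d, x (k + 1) - x k⟫ = ⟪Kt d, x (k + 1) - xstar⟫ - ⟪Kt d, x k - xstar⟫ := by
      rw [ex, inner_sub_right]
    have e2 : ⟪Kt (ystar - ybar k), x (k + 1) - xstar⟫ + ⟪Kt (y (k + 1) - ystar), x (k + 1) - xstar⟫
        = ⟪Kt (y (k + 1)) - Kt (y k), x (k + 1) - xstar⟫ - θ * ⟪Kt d, x (k + 1) - xstar⟫ := by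
      rw [← inner_add_left, ← real_inner_smul_left, ← inner_sub_left, hd]
      congr 1
      simp only [map_sub, map_add, map_smul]
      abel
    have c' := mul_le_mul_of_nonneg_left c hθ0.le
    rw [e1] at c'
    have c2 : θ * ((1 / ηx) * ‖x (k + 1) - x k‖ ^ 2) ≤ (1 / ηx) * ‖x (k + 1) - x k‖ ^ 2 :=
      mul_le_of_le_one_left (by positivity) hθ1
    have r : θ * ((1 + 2 * μx * ηx) * (1 / ηx) * ‖x k - xstar‖ ^ 2
        + (1 + 2 * μy * ηy) * (1 / ηy) * ‖y k - ystar‖ ^ 2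
        + (1 / ηy) * ‖d‖ ^ 2 - 2 * ⟪Kt d, x k - xstar⟫)
        = (1 / ηx) * ‖x k - xstar‖ ^ 2 + (1 / ηy) * ‖y k - ystar‖ ^ 2
          + θ * ((1 / ηy) * ‖d‖ ^ 2) - 2 * (θ * ⟪Kt d, x k - xstar⟫) := by
      linear_combination ((1 / ηx) * ‖x k - xstar‖ ^ 2) * hθx
        + ((1 / ηy) * ‖y k - ystar‖ ^ 2) * hθy
    rw [r, hΔ]
    linarith
  have hrec : ∀ k, Δ (k + 1) ≤ θ * Δ k := by
    intro k
    cases k with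
    | zero =>
      have := step 0 0 (by simp [hybar0])
      rw [hΔ0]
      simpa using this
    | succ k =>
      have := step (k + 1) (y (k + 1) - y k) (hybarupd k)
      rw [hΔ k]
      rw [map_sub] at this
      exact this
  intro k
  constructor
  · cases k with
    | zero => rw [hΔ0]; positivity
    | succ k =>
      rw [hΔ, ← map_sub]
      have c := cross (y (k + 1) - y k) (x (k + 1) - xstar)
      have h1 : (1 + 2 * μx * ηx) * (1 / ηx) * ‖x (k + 1) - xstar‖ ^ 2
          = (1 / ηx) * ‖x (k + 1) - xstar‖ ^ 2
            + 2 * (μx * ηx) * (1 / ηx) * ‖x (k + 1) - xstar‖ ^ 2 := by ring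
      have h2 : 0 ≤ 2 * (μx * ηx) * (1 / ηx) * ‖x (k + 1) - xstar‖ ^ 2 := by positivity
      have h3 : 0 ≤ (1 + 2 * μy * ηy) * (1 / ηy) * ‖y (k + 1) - ystar‖ ^ 2 := by positivity
      linarith
  · induction k with
    | zero => simp
    | succ k ih =>
      calc Δ (k + 1) ≤ θ * Δ k := hrec k
        _ ≤ θ * (θ ^ k * Δ 0) := mul_le_mul_of_nonneg_left ih hθ0.le
        _ = θ ^ (k + 1) * Δ 0 := by ring
end

section
/- (Nonnegativity of the Chambolle–Pock Lyapunov function; step of the proof of Theorem 13.) Let L_xy > 0 satisfy ‖K x‖ ≤ L_xy‖x‖ for all x ∈ E_x, let μ_x, μ_y ≥ 0, and let η_x, η_y > 0 satisfy L_xy² η_x η_y ≤ 1. Then for any x', x* ∈ E_x and any y', y, y* ∈ E_y, (1+2μ_xη_x)(1/η_x)‖x' − x*‖² + (1+2μ_yη_y)(1/η_y)‖y' − y*‖² + (1/η_y)‖y' − y‖² − 2⟨K^⊤(y' − y), x' − x*⟩ ≥ 2μ_x‖x' − x*‖² + (1+2μ_yη_y)(1/η_y)‖y' − y*‖² ≥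 0. -/
open RealInnerProductSpace

/-- Nonnegativity of the Chambolle–Pock Lyapunov function (step of the proof of Theorem 13). -/
theorem cp_lyapunov_nonneg
    {Ex Ey : Type*}
    [NormedAddCommGroup Ex] [InnerProductSpace ℝ Ex] [FiniteDimensional ℝ Ex]
    [NormedAddCommGroup Ey] [InnerProductSpace ℝ Ey] [FiniteDimensional ℝ Ey]
    (K : Ex →ₗ[ℝ] Ey) (Kt : Ey →ₗ[ℝ] Ex)
    (hadj : ∀ (x : Ex) (y : Ey), ⟪K x, y⟫ = ⟪x, Kt y⟫)
    (Lxy : ℝ) (hLxy : 0 < Lxy) (hK : ∀ x : Ex, ‖K x‖ ≤ Lxy * ‖x‖)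
    (μx μy : ℝ) (hμx : 0 ≤ μx) (hμy : 0 ≤ μy)
    (ηx ηy : ℝ) (hηx : 0 < ηx) (hηy : 0 < ηy)
    (hstep : Lxy ^ 2 * ηx * ηy ≤ 1)
    (x' xstar : Ex) (y' y ystar : Ey) :
    (1 + 2 * μx * ηx) * (1 / ηx) * ‖x' - xstar‖ ^ 2
        + (1 + 2 * μy * ηy) * (1 / ηy) * ‖y' - ystar‖ ^ 2
        + (1 / ηy) * ‖y' - y‖ ^ 2
        - 2 * ⟪Kt (y' - y), x' - xstar⟫ ≥
      2 * μx * ‖x' - xstar‖ ^ 2 + (1 + 2 * μy * ηy) * (1 / ηy) * ‖y' - ystar‖ ^ 2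
    ∧ 2 * μx * ‖x' - xstar‖ ^ 2 + (1 + 2 * μy * ηy) * (1 / ηy) * ‖y' - ystar‖ ^ 2 ≥ 0 := by
  refine ⟨?_, by positivity⟩
  have h1 : ⟪Kt (y' - y), x' - xstar⟫ ≤ Lxy * ‖x' - xstar‖ * ‖y' - y‖ := by
    rw [real_inner_comm, ← hadj]
    exact (real_inner_le_norm _ _).trans
      (mul_le_mul_of_nonneg_right (hK _) (norm_nonneg _))
  have h2 : Lxy ^ 2 * ηy ≤ 1 / ηx := by
    rw [le_div_iff₀ hηx]; linarith
  have h3 := mul_le_mul_of_nonneg_right h2 (sq_nonneg ‖x' - xstar‖)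
  have h4 : 0 ≤ (‖y' - y‖ - ηy * Lxy * ‖x' - xstar‖) ^ 2 / ηy := by positivity
  have h5 : (‖y' - y‖ - ηy * Lxy * ‖x' - xstar‖) ^ 2 / ηy
      = (1 / ηy) * ‖y' - y‖ ^ 2 - 2 * (Lxy * ‖x' - xstar‖ * ‖y' - y‖)
        + Lxy ^ 2 * ηy * ‖x' - xstar‖ ^ 2 := by
    field_simp
    ring
  have h6 : (1 + 2 * μx * ηx) * (1 / ηx) * ‖x' - xstar‖ ^ 2
      = 1 / ηx * ‖x' - xstar‖ ^ 2 + 2 * μx * ‖x' - xstar‖ ^ 2 := by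
    field_simp
  rw [h5] at h4
  rw [h6]
  linarith
end

section
/- (APDA primal descent, Lemma 14.) Let G be differentiable, μ_x-strongly convex and L_x-smooth, and suppose ∇G(x*) + K^⊤y* = 0. Let η_x > 0, let x, x' ∈ E_x and ȳ ∈ E_y satisfy x' = x − η_x (∇G(x') + K^⊤ ȳ). Then (1 + μ_x η_x)(1/η_x)‖x' − x*‖² ≤ (1/η_x)‖x − x*‖² − (1/η_x)‖x' − x‖² − 2⟨K^⊤ ȳ − K^⊤ y*, x' − x*⟩ − (1/L_x)‖∇G(x') − ∇G(x*)‖². -/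
open RealInnerProductSpace

theorem apda_desc {E : Type*} [NormedAddCommGroup E] [InnerProductSpace ℝ E] [CompleteSpace E]
    (G : E → ℝ) (G' : E → E) (hgrad : ∀ u, HasGradientAt G (G' u) u)
    (L : ℝ) (hsmooth : ∀ u v, ‖G' u - G' v‖ ≤ L * ‖u - v‖) (u d : E) :
    G (u + d) ≤ G u + ⟪G' u, d⟫ + L / 2 * ‖d‖ ^ 2 := by
  have hd : ∀ t : ℝ, HasDerivAt (fun t : ℝ => G (u + t • d) - t * ⟪G' u, d⟫ - L / 2 * t ^ 2 * ‖d‖ ^ 2)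
      (⟪G' (u + t • d), d⟫ - ⟪G' u, d⟫ - L * t * ‖d‖ ^ 2) t := by
    intro t
    have h1 : HasDerivAt (fun t : ℝ => u + t • d) d t := by
      simpa using ((hasDerivAt_id t).smul_const d).const_add u
    have h2 := (hgrad (u + t • d)).hasFDerivAt.comp_hasDerivAt t h1
    have h3 : HasDerivAt (fun t : ℝ => t * ⟪G' u, d⟫) ⟪G' u, d⟫ t := by
      simpa using (hasDerivAt_id t).mul_const ⟪G' u, d⟫
    have h4 := (((hasDerivAt_id t).pow 2).const_mul (L / 2)).mul_const (‖d‖ ^ 2)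
    have h5 := (h2.sub h3).sub h4
    refine h5.congr_deriv ?_
    simp only [InnerProductSpace.toDual_apply_apply, id]
    push_cast
    ring
  have ha : AntitoneOn (fun t : ℝ => G (u + t • d) - t * ⟪G' u, d⟫ - L / 2 * t ^ 2 * ‖d‖ ^ 2)
      (Set.Ici 0) := by
    refine antitoneOn_of_deriv_nonpos (convex_Ici 0)
      (fun t _ => (hd t).continuousAt.continuousWithinAt)
      (fun t _ => (hd t).differentiableAt.differentiableWithinAt) ?_
    intro t ht
    rw [interior_Ici, Set.mem_Ioi] at ht
    rw [(hd t).deriv, ← inner_sub_left]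
    have h1 := real_inner_le_norm (G' (u + t • d) - G' u) d
    have h2 := hsmooth (u + t • d) u
    rw [add_sub_cancel_left, norm_smul, Real.norm_of_nonneg ht.le] at h2
    have h3 := mul_le_mul_of_nonneg_right h2 (norm_nonneg d)
    nlinarith
  have := ha (show (0:ℝ) ∈ Set.Ici 0 by simp) (show (1:ℝ) ∈ Set.Ici 0 by simp) zero_le_one
  simp at this
  linarith

theorem apda_half {E : Type*} [NormedAddCommGroup E] [InnerProductSpace ℝ E] [CompleteSpace E]
    (G : E → ℝ) (G' : E → E) (hgrad : ∀ u, HasGradientAt G (G' u) u)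
    (L : ℝ) (hL : 0 < L) (hsmooth : ∀ u v, ‖G' u - G' v‖ ≤ L * ‖u - v‖)
    (hc : ∀ u v, G u + ⟪G' u, v - u⟫ ≤ G v) (u v : E) :
    G u + ⟪G' u, v - u⟫ + 1 / L / 2 * ‖G' v - G' u‖ ^ 2 ≤ G v := by
  have h1 := apda_desc G G' hgrad L hsmooth v (-(1 / L) • (G' v - G' u))
  have h2 := hc u (v + -(1 / L) • (G' v - G' u))
  have e : v + -(1 / L) • (G' v - G' u) - u = (v - u) + -(1 / L) • (G' v - G' u) := by abel
  rw [e, inner_add_right, inner_smul_right] at h2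
  rw [norm_smul, inner_smul_right, mul_pow, Real.norm_eq_abs, sq_abs] at h1
  have h3 : ⟪G' v, G' v - G' u⟫ - ⟪G' u, G' v - G' u⟫ = ‖G' v - G' u‖ ^ 2 := by
    rw [← inner_sub_left, real_inner_self_eq_norm_sq]
  have h4 : L / 2 * ((-(1 / L)) ^ 2 * ‖G' v - G' u‖ ^ 2) = 1 / L / 2 * ‖G' v - G' u‖ ^ 2 := by
    field_simp
  rw [h4] at h1
  have h5 := congrArg (fun r => 1 / L * r) h3
  simp only [mul_sub] at h5
  linarith

/-- APDA primal descent (Lemma 14). -/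
theorem apda_primal_descent
    {Ex Ey : Type*}
    [NormedAddCommGroup Ex] [InnerProductSpace ℝ Ex] [FiniteDimensional ℝ Ex]
    [NormedAddCommGroup Ey] [InnerProductSpace ℝ Ey] [FiniteDimensional ℝ Ey]
    (K : Ex →ₗ[ℝ] Ey) (Kt : Ey →ₗ[ℝ] Ex)
    (hadj : ∀ (x : Ex) (y : Ey), ⟪K x, y⟫ = ⟪x, Kt y⟫)
    (G : Ex → ℝ) (G' : Ex → Ex)
    (hgrad : ∀ u, HasGradientAt G (G' u) u)
    (μx : ℝ) (hμx : 0 < μx)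
    (hsc : ∀ u v, G u + ⟪G' u, v - u⟫ + μx / 2 * ‖v - u‖ ^ 2 ≤ G v)
    (Lx : ℝ) (hLx : 0 < Lx)
    (hsmooth : ∀ u v, ‖G' u - G' v‖ ≤ Lx * ‖u - v‖)
    (xstar : Ex) (ystar : Ey)
    (hopt : G' xstar + Kt ystar = 0)
    (ηx : ℝ) (hηx : 0 < ηx)
    (x x' : Ex) (ybar : Ey)
    (hupd : x' = x - ηx • (G' x' + Kt ybar)) :
    (1 + μx * ηx) * (1 / ηx) * ‖x' - xstar‖ ^ 2 ≤
      (1 / ηx) * ‖x - xstar‖ ^ 2 - (1 / ηx) * ‖x' - x‖ ^ 2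
        - 2 * ⟪Kt ybar - Kt ystar, x' - xstar⟫
        - (1 / Lx) * ‖G' x' - G' xstar‖ ^ 2 := by
  have hc : ∀ u v, G u + ⟪G' u, v - u⟫ ≤ G v := fun u v => by
    have := hsc u v
    have : 0 ≤ μx / 2 * ‖v - u‖ ^ 2 := by positivity
    linarith
  have : CompleteSpace Ex := FiniteDimensional.complete ℝ Ex
  have a1 := apda_half G G' hgrad Lx hLx hsmooth hc x' xstar
  have a2 := apda_half G G' hgrad Lx hLx hsmooth hc xstar x'
  have b1 := hsc x' xstar
  have b2 := hsc xstar x'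
  rw [norm_sub_rev (G' xstar)] at a1
  rw [norm_sub_rev xstar] at b1
  have e : ⟪G' x', xstar - x'⟫ = -⟪G' x', x' - xstar⟫ := by
    rw [← inner_neg_right, neg_sub]
  rw [e] at a1 b1
  have hK : Kt ystar = - G' xstar := (neg_eq_of_add_eq_zero_right hopt).symm
  have hx : x - xstar = (x' - xstar) + ηx • (G' x' + Kt ybar) := by
    nth_rewrite 1 [hupd]; abel
  have hx2 : x' - x = -(ηx • (G' x' + Kt ybar)) := by
    nth_rewrite 1 [hupd]; abel
  rw [hx, hx2, norm_neg, norm_add_sq_real, inner_smul_right, hK,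
    inner_sub_left (Kt ybar), inner_neg_left,
    real_inner_comm (G' x' + Kt ybar) (x' - xstar), inner_add_left]
  have f1 : (1 + μx * ηx) * (1 / ηx) * ‖x' - xstar‖ ^ 2
      = 1 / ηx * ‖x' - xstar‖ ^ 2 + μx * ‖x' - xstar‖ ^ 2 := by
    field_simp
  have f2 : ∀ a b c : ℝ, 1 / ηx * (a + 2 * (ηx * b) + c) - 1 / ηx * c = 1 / ηx * a + 2 * b := by
    intro a b c
    field_simp
    ring
  rw [f1, f2]
  linarith
end

section
/- (APDA dual descent, Lemma 16 / Lemma 19.) Let G be differentiable, convex and L_x-smooth, F* be convex, L_xy > 0 satisfy ‖K x‖ ≤ L_xy‖x‖ for all x, and let μ_xy > 0 satisfy ‖K^⊤(y − y*)‖ ≥ μ_xy‖y − y*‖ for all y ∈ E_y. Suppose (x*, y*) satisfies ∇G(x*) + K^⊤y* = 0 and K x* ∈ ∂F*(y*). Let η_y > 0 and 0 ≤ β_y ≤ 1/(2 L_xy² η_y). Let y, y' ∈ E_y, x̂ ∈ E_x, and h ∈ ∂F*(y') be such that y' = y − η_y (h − K x̂) − η_y β_y K (K^⊤ y + ∇G(x̂)).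 Then (1/η_y)‖y' − y*‖² ≤ (1 − μ_xy² β_y η_y)(1/η_y)‖y − y*‖² − (1/(2η_y))‖y' − y‖² + 2⟨K^⊤ y' − K^⊤ y*, x̂ − x*⟩ + β_y‖∇G(x̂) − ∇G(x*)‖². -/
open RealInnerProductSpace

/-- APDA dual descent (Lemma 16 / Lemma 19). -/
theorem apda_dual_descent
    {Ex Ey : Type*}
    [NormedAddCommGroup Ex] [InnerProductSpace ℝ Ex] [FiniteDimensional ℝ Ex]
    [NormedAddCommGroup Ey] [InnerProductSpace ℝ Ey] [FiniteDimensional ℝ Ey]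
    (K : Ex →ₗ[ℝ] Ey) (Kt : Ey →ₗ[ℝ] Ex)
    (hadj : ∀ (x : Ex) (y : Ey), ⟪K x, y⟫ = ⟪x, Kt y⟫)
    (Lxy : ℝ) (hLxy : 0 < Lxy) (hK : ∀ x : Ex, ‖K x‖ ≤ Lxy * ‖x‖)
    (G : Ex → ℝ) (G' : Ex → Ex)
    (hgrad : ∀ u, HasGradientAt G (G' u) u)
    (hconv : ∀ u v, G u + ⟪G' u, v - u⟫ ≤ G v)
    (Lx : ℝ) (hLx : 0 < Lx)
    (hsmooth : ∀ u v, ‖G' u - G' v‖ ≤ Lx * ‖u - v‖)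
    (Fs : Ey → ℝ) (hFs : ConvexOn ℝ Set.univ Fs)
    (xstar : Ex) (ystar : Ey)
    (μxy : ℝ) (hμxy : 0 < μxy)
    (hKt : ∀ y : Ey, ‖Kt (y - ystar)‖ ≥ μxy * ‖y - ystar‖)
    (hoptx : G' xstar + Kt ystar = 0)
    (hopty : IsSubgradientAt Fs (K xstar) ystar)
    (ηy βy : ℝ) (hηy : 0 < ηy)
    (hβy0 : 0 ≤ βy) (hβy : βy ≤ 1 / (2 * Lxy ^ 2 * ηy))
    (y y' : Ey) (xhat : Ex) (h : Ey)
    (hh : IsSubgradientAt Fs h y')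
    (hupd : y' = y - ηy • (h - K xhat) - (ηy * βy) • K (Kt y + G' xhat)) :
    (1 / ηy) * ‖y' - ystar‖ ^ 2 ≤
      (1 - μxy ^ 2 * βy * ηy) * (1 / ηy) * ‖y - ystar‖ ^ 2
        - (1 / (2 * ηy)) * ‖y' - y‖ ^ 2
        + 2 * ⟪Kt y' - Kt ystar, xhat - xstar⟫
        + βy * ‖G' xhat - G' xstar‖ ^ 2 := by
  have hμ : μxy ^ 2 * ‖y - ystar‖ ^ 2 ≤ ‖Kt (y - ystar)‖ ^ 2 := by
    rw [← mul_pow]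
    exact pow_le_pow_left₀ (by positivity) (hKt y) 2
  have hKtn : ∀ s : Ey, ‖Kt s‖ ≤ Lxy * ‖s‖ := by
    intro s
    have h1 : ‖Kt s‖ * ‖Kt s‖ ≤ (Lxy * ‖s‖) * ‖Kt s‖ := by
      rw [← real_inner_self_eq_norm_mul_norm, ← hadj]
      calc ⟪K (Kt s), s⟫ ≤ ‖K (Kt s)‖ * ‖s‖ := real_inner_le_norm _ _
        _ ≤ (Lxy * ‖Kt s‖) * ‖s‖ := by gcongr; exact hK _
        _ = _ := by ring
    rcases (norm_nonneg (Kt s)).eq_or_lt with h0 | h0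
    · rw [← h0]; positivity
    · exact le_of_mul_le_mul_right h1 h0
  have hb : βy * ‖Kt (y' - y)‖ ^ 2 ≤ (1 / (2 * ηy)) * ‖y' - y‖ ^ 2 := by
    calc βy * ‖Kt (y' - y)‖ ^ 2
        ≤ (1 / (2 * Lxy ^ 2 * ηy)) * (Lxy * ‖y' - y‖) ^ 2 := by
          gcongr; exact hKtn _
      _ = _ := by field_simp
  have hmono : 0 ≤ ⟪h - K xstar, y' - ystar⟫ := by
    have h1 := hh ystar
    have h2 := hopty y'
    rw [← neg_sub y' ystar, inner_neg_right] at h1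
    rw [inner_sub_left]
    linarith
  have hac : Kt y + G' xhat = Kt (y - ystar) + (G' xhat - G' xstar) := by
    rw [eq_neg_of_add_eq_zero_left hoptx, map_sub]; abel
  have he : Kt (y' - ystar) = Kt (y - ystar) + Kt (y' - y) := by
    rw [← map_add]; congr 1; abel
  have hs : y' - y = (-ηy) • (h - K xhat) - (ηy * βy) • K (Kt (y - ystar) + (G' xhat - G' xstar)) := by
    rw [← hac, neg_smul]; nth_rewrite 1 [hupd]; abel
  have hse : ⟪y' - y, y' - ystar⟫ = -ηy * ⟪h - K xhat, y' - ystar⟫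
      - (ηy * βy) * ⟪Kt (y - ystar) + (G' xhat - G' xstar), Kt (y - ystar) + Kt (y' - y)⟫ := by
    conv_lhs => rw [hs]
    rw [inner_sub_left, real_inner_smul_left, real_inner_smul_left, hadj, he]
  have hsplit : ⟪h - K xhat, y' - ystar⟫
      = ⟪h - K xstar, y' - ystar⟫ - ⟪Kt y' - Kt ystar, xhat - xstar⟫ := by
    rw [← map_sub Kt, real_inner_comm (xhat - xstar), ← hadj, ← inner_sub_left, map_sub]
    congr 1; abel
  have hd : ‖y - ystar‖ ^ 2 = ‖y' - ystar‖ ^ 2 - 2 * ⟪y' - y, y' - ystar⟫ + ‖y' - y‖ ^ 2 := by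
    have : y - ystar = (y' - ystar) - (y' - y) := by abel
    rw [this, norm_sub_sq_real, real_inner_comm]
  generalize Kt (y - ystar) = a at *
  generalize Kt (y' - y) = b at *
  generalize G' xhat - G' xstar = c at *
  have hq : -2 * ⟪a + c, a + b⟫ ≤ - ‖a‖ ^ 2 + ‖c‖ ^ 2 + ‖b‖ ^ 2 := by
    have h1 : 0 ≤ ‖(a + c) + b‖ ^ 2 := by positivity
    rw [norm_add_sq_real, norm_add_sq_real, inner_add_left] at h1
    rw [inner_add_left, inner_add_right, inner_add_right, real_inner_self_eq_norm_sq,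
      real_inner_comm a c]
    linarith
  have hq' := mul_le_mul_of_nonneg_left hq hβy0
  have hμ' := mul_le_mul_of_nonneg_left hμ hβy0
  have key : (1 / ηy) * ‖y' - ystar‖ ^ 2 = (1 / ηy) * ‖y - ystar‖ ^ 2 - (1 / ηy) * ‖y' - y‖ ^ 2
      - 2 * ⟪h - K xhat, y' - ystar⟫ - 2 * βy * ⟪a + c, a + b⟫ := by
    rw [hd, hse]; field_simp; ring
  have e1 : (1 - μxy ^ 2 * βy * ηy) * (1 / ηy) * ‖y - ystar‖ ^ 2
      = (1 / ηy) * ‖y - ystar‖ ^ 2 - βy * (μxy ^ 2 * ‖y - ystar‖ ^ 2) := by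
    field_simp
  have e2 : (1 / ηy) * ‖y' - y‖ ^ 2 = 2 * ((1 / (2 * ηy)) * ‖y' - y‖ ^ 2) := by
    field_simp
  rw [key, e1, e2, hsplit]
  linarith
end

section
/- (Convergence of APDA, Theorem 17.) Let G be differentiable, μ_x-strongly convex and L_x-smooth, F* be convex, L_xy > 0 satisfy ‖K x‖ ≤ L_xy‖x‖ for all x, and let 0 < μ_xy ≤ L_xy satisfy ‖K^⊤(y − y*)‖ ≥ μ_xy‖y − y*‖ for all y ∈ E_y. Suppose (x*, y*) satisfies ∇G(x*) + K^⊤y* = 0 and K x* ∈ ∂F*(y*). Set η_x = (1/(2√(L_x μ_x)))·(μ_xy/L_xy), η_y = √(L_x μ_x)/(L_xy μ_xy), β_y = min{1/L_x, 1/(2L_xy²η_y)}, and θ = max{1/(1 + μ_xη_x), 1 − μ_xy²β_yη_y}. Let sequences (x^k), (y^k), (ȳ^k) and subgradients h^k ∈ ∂F*(y^{k+1}) satisfy, for all k ≥ 0: x^{k+1} = x^k − η_x (∇G(x^{k+1}) + K^⊤ ȳ^k); y^{k+1} = y^k − η_y (h^k − K x^{k+1}) − η_y β_y K (K^⊤ y^k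 + ∇G(x^{k+1})); ȳ^0 = y^0; ȳ^{k+1} = y^{k+1} + θ(y^{k+1} − y^k). Define, for k ≥ 0, Δ^{k+1} := (1+μ_xη_x)(1/η_x)‖x^{k+1} − x*‖² + (1/η_y)‖y^{k+1} − y*‖² + (1/(2η_y))‖y^{k+1} − y^k‖² − 2⟨K^⊤ y^{k+1} − K^⊤ y^k, x^{k+1} − x*⟩, and Δ^0 := (1+μ_xη_x)(1/η_x)‖x^0 − x*‖² + (1/η_y)‖y^0 − y*‖². Then for all k ≥ 0: μ_x‖x^{k+1} − x*‖² + (1/η_y)‖y^{k+1} − y*‖² ≤ Δ^{k+1}, and Δ^k ≤ θ^k Δ^0. -/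
open RealInnerProductSpace

theorem apda_descent {E : Type*} [NormedAddCommGroup E] [InnerProductSpace ℝ E] [CompleteSpace E]
    (G : E → ℝ) (G' : E → E) (hgrad : ∀ u, HasGradientAt G (G' u) u)
    (L : ℝ) (hs : ∀ u v, ‖G' u - G' v‖ ≤ L * ‖u - v‖) (v d : E) :
    G (v + d) ≤ G v + ⟪G' v, d⟫ + L / 2 * ‖d‖ ^ 2 := by
  have hd : ∀ t : ℝ, HasDerivAt (fun t : ℝ => G (v + t • d) - t * ⟪G' v, d⟫ - L / 2 * t ^ 2 * ‖d‖ ^ 2)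
      (⟪G' (v + t • d), d⟫ - ⟪G' v, d⟫ - L * t * ‖d‖ ^ 2) t := by
    intro t
    have h1 : HasDerivAt (fun t : ℝ => v + t • d) d t := by
      simpa using ((hasDerivAt_id t).smul_const d).const_add v
    have h2 := (hgrad (v + t • d)).hasFDerivAt.comp_hasDerivAt t h1
    have h3 : HasDerivAt (fun t : ℝ => G (v + t • d)) ⟪G' (v + t • d), d⟫ t := by
      simp only [InnerProductSpace.toDual_apply_apply] at h2
      exact h2
    have h4 : HasDerivAt (fun t : ℝ => t * ⟪G' v, d⟫) ⟪G' v, d⟫ t := by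
      simpa using (hasDerivAt_id t).mul_const ⟪G' v, d⟫
    have h5 : HasDerivAt (fun t : ℝ => L / 2 * t ^ 2 * ‖d‖ ^ 2) (L * t * ‖d‖ ^ 2) t := by
      have := (((hasDerivAt_pow 2 t).const_mul (L / 2)).mul_const (‖d‖ ^ 2))
      exact this.congr_deriv (by push_cast; ring)
    exact (h3.sub h4).sub h5
  have hanti : AntitoneOn (fun t : ℝ => G (v + t • d) - t * ⟪G' v, d⟫ - L / 2 * t ^ 2 * ‖d‖ ^ 2)
      (Set.Icc 0 1) := by
    apply antitoneOn_of_deriv_nonpos (convex_Icc 0 1)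
    · exact fun t _ => (hd t).continuousAt.continuousWithinAt
    · exact fun t _ => (hd t).differentiableAt.differentiableWithinAt
    · intro t ht
      rw [interior_Icc] at ht
      rw [(hd t).deriv]
      have h1 := hs (v + t • d) v
      rw [add_sub_cancel_left, norm_smul, Real.norm_of_nonneg ht.1.le] at h1
      have h2 := real_inner_le_norm (G' (v + t • d) - G' v) d
      rw [inner_sub_left] at h2
      nlinarith [norm_nonneg d, mul_le_mul_of_nonneg_right h1 (norm_nonneg d)]
  have := hanti (Set.left_mem_Icc.2 zero_le_one) (Set.right_mem_Icc.2 zero_le_one) zero_le_one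
  simp at this
  linarith

theorem apda_coco {E : Type*} [NormedAddCommGroup E] [InnerProductSpace ℝ E] [CompleteSpace E]
    (G : E → ℝ) (G' : E → E) (hgrad : ∀ u, HasGradientAt G (G' u) u)
    (μ : ℝ) (hμ : 0 < μ)
    (hsc : ∀ u v, G u + ⟪G' u, v - u⟫ + μ / 2 * ‖v - u‖ ^ 2 ≤ G v)
    (L : ℝ) (hL : 0 < L) (hs : ∀ u v, ‖G' u - G' v‖ ≤ L * ‖u - v‖) (u v : E) :
    μ * ‖u - v‖ ^ 2 + 1 / L * ‖G' u - G' v‖ ^ 2 ≤ 2 * ⟪G' u - G' v, u - v⟫ := by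
  have h1 := hsc u v
  have h2 := apda_descent G G' hgrad L hs u (-(1 / L) • (G' u - G' v))
  have h3 := hsc v (u + -(1 / L) • (G' u - G' v))
  have h3' : 0 ≤ μ / 2 * ‖u + -(1 / L) • (G' u - G' v) - v‖ ^ 2 := by positivity
  have e1 : u + -(1 / L) • (G' u - G' v) - v = (u - v) + -(1 / L) • (G' u - G' v) := by abel
  rw [e1] at h3 h3'
  rw [inner_add_right, real_inner_smul_right] at h3
  rw [real_inner_smul_right, norm_smul, mul_pow, Real.norm_eq_abs, sq_abs] at h2
  rw [← neg_sub u v, inner_neg_right, norm_neg] at h1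
  have e2 : L / 2 * ((-(1 / L)) ^ 2 * ‖G' u - G' v‖ ^ 2) = 1 / L * ‖G' u - G' v‖ ^ 2 / 2 := by
    field_simp
  rw [e2] at h2
  have e3 : ‖G' u - G' v‖ ^ 2 = ⟪G' u, G' u - G' v⟫ - ⟪G' v, G' u - G' v⟫ := by
    rw [← inner_sub_left, real_inner_self_eq_norm_sq]
  have e4 : 1 / L * ‖G' u - G' v‖ ^ 2 = 1 / L * ⟪G' u, G' u - G' v⟫ - 1 / L * ⟪G' v, G' u - G' v⟫ := by
    rw [e3]; ring
  rw [inner_sub_left]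
  linarith

theorem apda_adj {Ex Ey : Type*}
    [NormedAddCommGroup Ex] [InnerProductSpace ℝ Ex]
    [NormedAddCommGroup Ey] [InnerProductSpace ℝ Ey]
    (K : Ex →ₗ[ℝ] Ey) (Kt : Ey →ₗ[ℝ] Ex)
    (hadj : ∀ (x : Ex) (y : Ey), ⟪K x, y⟫ = ⟪x, Kt y⟫)
    (L : ℝ) (hL : 0 < L) (hK : ∀ x : Ex, ‖K x‖ ≤ L * ‖x‖) (y : Ey) : ‖Kt y‖ ≤ L * ‖y‖ := by
  have h1 := hadj (Kt y) y
  rw [real_inner_self_eq_norm_sq] at h1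
  have h2 := real_inner_le_norm (K (Kt y)) y
  have h3 := mul_le_mul_of_nonneg_right (hK (Kt y)) (norm_nonneg y)
  by_contra hc
  push Not at hc
  have h4 : 0 < ‖Kt y‖ := lt_of_le_of_lt (by positivity) hc
  nlinarith

theorem apda_young {E : Type*} [NormedAddCommGroup E] [InnerProductSpace ℝ E]
    (a b : E) (c : ℝ) (hc : 0 < c) : -(2 * ⟪a, b⟫) ≤ c * ‖a‖ ^ 2 + 1 / c * ‖b‖ ^ 2 := by
  have h1 := abs_le.1 (abs_real_inner_le_norm a b)
  have h2 : c * ‖a‖ ^ 2 + 1 / c * ‖b‖ ^ 2 - 2 * (‖a‖ * ‖b‖) = 1 / c * (c * ‖a‖ - ‖b‖) ^ 2 := by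
    field_simp
    ring
  have h3 : 0 ≤ 1 / c * (c * ‖a‖ - ‖b‖) ^ 2 := by positivity
  linarith [h1.1]

set_option maxHeartbeats 2000000 in
theorem apda_step {Ex Ey : Type*}
    [NormedAddCommGroup Ex] [InnerProductSpace ℝ Ex]
    [NormedAddCommGroup Ey] [InnerProductSpace ℝ Ey]
    (K : Ex →ₗ[ℝ] Ey) (Kt : Ey →ₗ[ℝ] Ex)
    (hadj : ∀ (x : Ex) (y : Ey), ⟪K x, y⟫ = ⟪x, Kt y⟫)
    (L μ Lx μxy ηx ηy β θ : ℝ)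
    (hKtL : ∀ y, ‖Kt y‖ ≤ L * ‖y‖) (hL : 0 < L) (hμ : 0 < μ) (hμxy : 0 < μxy)
    (hx0 : 0 < ηx) (hy0 : 0 < ηy) (hb0 : 0 < β) (hprod : ηx * L ^ 2 = 1 / (2 * ηy))
    (hb1 : β ≤ 1 / Lx) (hb2 : β * L ^ 2 ≤ 1 / (2 * ηy))
    (ht1 : 1 ≤ θ * (1 + μ * ηx)) (ht2 : 1 - μxy ^ 2 * β * ηy ≤ θ) (ht0 : 0 < θ) (ht : θ ≤ 1)
    (X X0 g : Ex) (Y Y0 D D0 s : Ey) (hD : Y = Y0 + D)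
    (hX : X - X0 = -(ηx • (g + Kt (Y0 + θ • D0))))
    (hY : D = -(ηy • (s - K X)) - (ηy * β) • K (Kt Y0 + g))
    (hg : μ * ‖X‖ ^ 2 + 1 / Lx * ‖g‖ ^ 2 ≤ 2 * ⟪g, X⟫)
    (hs : 0 ≤ ⟪s, Y⟫) (hY0 : μxy * ‖Y0‖ ≤ ‖Kt Y0‖) :
    (1 + μ * ηx) * (1 / ηx) * ‖X‖ ^ 2 + (1 / ηy) * ‖Y‖ ^ 2 + (1 / (2 * ηy)) * ‖D‖ ^ 2
        - 2 * ⟪Kt D, X⟫ ≤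
    θ * ((1 + μ * ηx) * (1 / ηx) * ‖X0‖ ^ 2 + (1 / ηy) * ‖Y0‖ ^ 2 + (1 / (2 * ηy)) * ‖D0‖ ^ 2
        - 2 * ⟪Kt D0, X0⟫) := by
  -- x part
  have a1 : ‖X‖ ^ 2 - ‖X0‖ ^ 2 + ‖X - X0‖ ^ 2 = 2 * ⟪X - X0, X⟫ := by
    rw [norm_sub_sq_real, inner_sub_left, real_inner_self_eq_norm_sq, real_inner_comm X X0]; ring
  have a2 : (1 / ηx) * (2 * ⟪X - X0, X⟫)
      = -(2 * ⟪g, X⟫) - 2 * ⟪Kt Y0, X⟫ - 2 * θ * ⟪Kt D0, X⟫ := by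
    rw [hX, inner_neg_left, real_inner_smul_left, map_add, map_smul, inner_add_left,
      inner_add_left, real_inner_smul_left]
    field_simp
    ring
  -- y part
  have b1 : ‖Y‖ ^ 2 - ‖Y0‖ ^ 2 + ‖D‖ ^ 2 = 2 * ⟪D, Y⟫ := by
    rw [hD, norm_add_sq_real, inner_add_right, real_inner_self_eq_norm_sq, real_inner_comm D Y0]
    ring
  have b2 : (1 / ηy) * (2 * ⟪D, Y⟫)
      = -(2 * ⟪s, Y⟫) + 2 * ⟪Kt Y, X⟫ - 2 * β * ⟪Kt Y0 + g, Kt Y⟫ := by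
    have : ⟪D, Y⟫ = -(ηy * (⟪s, Y⟫ - ⟪K X, Y⟫)) - ηy * β * ⟪K (Kt Y0 + g), Y⟫ := by
      conv_lhs => rw [hY]
      rw [inner_sub_left, inner_neg_left, real_inner_smul_left, real_inner_smul_left,
        inner_sub_left]
    rw [this, hadj, hadj, real_inner_comm X (Kt Y)]
    field_simp
    ring
  have b3 : -(2 * ⟪Kt Y0 + g, Kt Y⟫) ≤ -‖Kt Y0‖ ^ 2 + ‖g‖ ^ 2 + ‖Kt D‖ ^ 2 := by
    have e : ‖(Kt Y0 + g) + Kt D‖ ^ 2 = ‖Kt Y0 + g‖ ^ 2 + 2 * ⟪Kt Y0 + g, Kt D⟫ + ‖Kt D‖ ^ 2 :=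
      norm_add_sq_real _ _
    have e' : ‖g‖ ^ 2 = ‖Kt Y0 + g‖ ^ 2 - 2 * ⟪Kt Y0 + g, Kt Y0⟫ + ‖Kt Y0‖ ^ 2 := by
      rw [← norm_sub_sq_real, add_sub_cancel_left]
    rw [hD, map_add, inner_add_right]
    nlinarith [sq_nonneg ‖(Kt Y0 + g) + Kt D‖]
  have b4 : β * (μxy ^ 2 * ‖Y0‖ ^ 2) ≤ β * ‖Kt Y0‖ ^ 2 := by
    rw [← mul_pow]; gcongr
  have b5 : β * ‖Kt D‖ ^ 2 ≤ 1 / (2 * ηy) * ‖D‖ ^ 2 := by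
    calc β * ‖Kt D‖ ^ 2 ≤ β * (L * ‖D‖) ^ 2 := by gcongr; exact hKtL D
      _ = β * L ^ 2 * ‖D‖ ^ 2 := by ring
      _ ≤ _ := by gcongr
  have b6 : β * ‖g‖ ^ 2 ≤ 1 / Lx * ‖g‖ ^ 2 := by gcongr
  have b7 := mul_le_mul_of_nonneg_left b3 hb0.le
  -- cross term
  have c1 := apda_young (θ • Kt D0) (X - X0) ηx hx0
  rw [norm_smul, Real.norm_of_nonneg ht0.le, real_inner_smul_left, inner_sub_right] at c1
  have c2 : ηx * (θ * ‖Kt D0‖) ^ 2 ≤ θ * (1 / (2 * ηy) * ‖D0‖ ^ 2) := by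
    calc ηx * (θ * ‖Kt D0‖) ^ 2 ≤ ηx * (θ * (L * ‖D0‖)) ^ 2 := by gcongr; exact hKtL D0
      _ = θ * θ * (ηx * L ^ 2 * ‖D0‖ ^ 2) := by ring
      _ = θ * θ * (1 / (2 * ηy) * ‖D0‖ ^ 2) := by rw [hprod]
      _ ≤ θ * 1 * (1 / (2 * ηy) * ‖D0‖ ^ 2) := by gcongr
      _ = _ := by ring
  have c3 : 1 / ηx * ‖X0‖ ^ 2 ≤ θ * ((1 + μ * ηx) * (1 / ηx) * ‖X0‖ ^ 2) := by
    have : 0 ≤ 1 / ηx * ‖X0‖ ^ 2 := by positivity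
    nlinarith
  have c4 : 1 / ηy * ‖Y0‖ ^ 2 - β * (μxy ^ 2 * ‖Y0‖ ^ 2) ≤ θ * (1 / ηy * ‖Y0‖ ^ 2) := by
    have e : 1 / ηy * ‖Y0‖ ^ 2 - β * (μxy ^ 2 * ‖Y0‖ ^ 2)
        = (1 - μxy ^ 2 * β * ηy) * (1 / ηy * ‖Y0‖ ^ 2) := by
      field_simp
    rw [e]; gcongr
  have d1 : (1 + μ * ηx) * (1 / ηx) * ‖X‖ ^ 2 = 1 / ηx * ‖X‖ ^ 2 + μ * ‖X‖ ^ 2 := by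
    field_simp
  have d2 : ⟪Kt Y, X⟫ = ⟪Kt Y0, X⟫ + ⟪Kt D, X⟫ := by rw [hD, map_add, inner_add_left]
  rw [← a1] at a2
  rw [← b1, d2] at b2
  rw [d1]
  have e1 : 1 / ηy * ‖D‖ ^ 2 = 2 * (1 / (2 * ηy) * ‖D‖ ^ 2) := by field_simp
  linarith

/-- Convergence of APDA (Theorem 17). -/
theorem apda_convergence
    {Ex Ey : Type*}
    [NormedAddCommGroup Ex] [InnerProductSpace ℝ Ex] [FiniteDimensional ℝ Ex]
    [NormedAddCommGroup Ey] [InnerProductSpace ℝ Ey] [FiniteDimensional ℝ Ey]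
    (K : Ex →ₗ[ℝ] Ey) (Kt : Ey →ₗ[ℝ] Ex)
    (hadj : ∀ (x : Ex) (y : Ey), ⟪K x, y⟫ = ⟪x, Kt y⟫)
    (Lxy : ℝ) (hLxy : 0 < Lxy) (hK : ∀ x : Ex, ‖K x‖ ≤ Lxy * ‖x‖)
    (G : Ex → ℝ) (G' : Ex → Ex)
    (hgrad : ∀ u, HasGradientAt G (G' u) u)
    (μx : ℝ) (hμx : 0 < μx)
    (hsc : ∀ u v, G u + ⟪G' u, v - u⟫ + μx / 2 * ‖v - u‖ ^ 2 ≤ G v)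
    (Lx : ℝ) (hLx : 0 < Lx)
    (hsmooth : ∀ u v, ‖G' u - G' v‖ ≤ Lx * ‖u - v‖)
    (Fs : Ey → ℝ) (hFs : ConvexOn ℝ Set.univ Fs)
    (xstar : Ex) (ystar : Ey)
    (μxy : ℝ) (hμxy : 0 < μxy) (hμxyL : μxy ≤ Lxy)
    (hKt : ∀ y : Ey, ‖Kt (y - ystar)‖ ≥ μxy * ‖y - ystar‖)
    (hoptx : G' xstar + Kt ystar = 0)
    (hopty : IsSubgradientAt Fs (K xstar) ystar)
    (ηx ηy βy θ : ℝ)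
    (hηx : ηx = (1 / (2 * Real.sqrt (Lx * μx))) * (μxy / Lxy))
    (hηy : ηy = Real.sqrt (Lx * μx) / (Lxy * μxy))
    (hβy : βy = min (1 / Lx) (1 / (2 * Lxy ^ 2 * ηy)))
    (hθ : θ = max (1 / (1 + μx * ηx)) (1 - μxy ^ 2 * βy * ηy))
    (x : ℕ → Ex) (y ybar : ℕ → Ey) (h : ℕ → Ey)
    (hh : ∀ k, IsSubgradientAt Fs (h k) (y (k + 1)))
    (hxupd : ∀ k, x (k + 1) = x k - ηx • (G' (x (k + 1)) + Kt (ybar k)))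
    (hyupd : ∀ k, y (k + 1) = y k - ηy • (h k - K (x (k + 1)))
        - (ηy * βy) • K (Kt (y k) + G' (x (k + 1))))
    (hybar0 : ybar 0 = y 0)
    (hybarupd : ∀ k, ybar (k + 1) = y (k + 1) + θ • (y (k + 1) - y k))
    (Δ : ℕ → ℝ)
    (hΔ0 : Δ 0 = (1 + μx * ηx) * (1 / ηx) * ‖x 0 - xstar‖ ^ 2
        + (1 / ηy) * ‖y 0 - ystar‖ ^ 2)
    (hΔ : ∀ k, Δ (k + 1) =
        (1 + μx * ηx) * (1 / ηx) * ‖x (k + 1) - xstar‖ ^ 2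
        + (1 / ηy) * ‖y (k + 1) - ystar‖ ^ 2
        + (1 / (2 * ηy)) * ‖y (k + 1) - y k‖ ^ 2
        - 2 * ⟪Kt (y (k + 1)) - Kt (y k), x (k + 1) - xstar⟫) :
    ∀ k,
      (μx * ‖x (k + 1) - xstar‖ ^ 2 + (1 / ηy) * ‖y (k + 1) - ystar‖ ^ 2 ≤ Δ (k + 1))
      ∧ Δ k ≤ θ ^ k * Δ 0 := by
  have hS : 0 < Real.sqrt (Lx * μx) := Real.sqrt_pos.2 (by positivity)
  have hx0 : 0 < ηx := by rw [hηx]; positivity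
  have hy0 : 0 < ηy := by rw [hηy]; positivity
  have hb0 : 0 < βy := by rw [hβy]; exact lt_min (by positivity) (by positivity)
  have hprod : ηx * Lxy ^ 2 = 1 / (2 * ηy) := by
    rw [hηx, hηy]
    field_simp
  have hb1 : βy ≤ 1 / Lx := by rw [hβy]; exact min_le_left _ _
  have hb2 : βy * Lxy ^ 2 ≤ 1 / (2 * ηy) := by
    have h1 : βy ≤ 1 / (2 * Lxy ^ 2 * ηy) := by rw [hβy]; exact min_le_right _ _
    calc βy * Lxy ^ 2 ≤ 1 / (2 * Lxy ^ 2 * ηy) * Lxy ^ 2 := by gcongr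
      _ = _ := by field_simp
  have hp : 0 < 1 + μx * ηx := by positivity
  have ht1' : 1 / (1 + μx * ηx) ≤ θ := by rw [hθ]; exact le_max_left _ _
  have ht1 : 1 ≤ θ * (1 + μx * ηx) := (div_le_iff₀ hp).1 ht1'
  have ht2 : 1 - μxy ^ 2 * βy * ηy ≤ θ := by rw [hθ]; exact le_max_right _ _
  have ht0 : 0 < θ := lt_of_lt_of_le (by positivity) ht1'
  have ht : θ ≤ 1 := by
    rw [hθ]
    apply max_le
    · rw [div_le_one hp]
      have : 0 < μx * ηx := by positivity
      linarith
    · have : 0 < μxy ^ 2 * βy * ηy := by positivity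
      linarith
  have hKtL := apda_adj K Kt hadj Lxy hLxy hK
  have hstep : ∀ (k : ℕ) (D0 : Ey), ybar k = y k + θ • D0 →
      Δ (k + 1) ≤ θ * ((1 + μx * ηx) * (1 / ηx) * ‖x k - xstar‖ ^ 2
        + (1 / ηy) * ‖y k - ystar‖ ^ 2 + (1 / (2 * ηy)) * ‖D0‖ ^ 2
        - 2 * ⟪Kt D0, x k - xstar⟫) := by
    intro k D0 hyb
    have hGs : G' xstar = - Kt ystar := eq_neg_of_add_eq_zero_left hoptx
    rw [hΔ k, ← map_sub]
    refine apda_step K Kt hadj Lxy μx Lx μxy ηx ηy βy θ hKtL hLxy hμx hμxy hx0 hy0 hb0 hprod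
      hb1 hb2 ht1 ht2 ht0 ht (x (k + 1) - xstar) (x k - xstar) (G' (x (k + 1)) - G' xstar)
      (y (k + 1) - ystar) (y k - ystar) (y (k + 1) - y k) D0 (h k - K xstar) (by abel) ?_ ?_ ?_ ?_ ?_
    · have e : G' (x (k + 1)) - G' xstar + Kt (y k - ystar + θ • D0)
          = G' (x (k + 1)) + Kt (ybar k) := by
        rw [hyb, hGs]; simp only [map_add, map_sub]; abel
      rw [e, sub_sub_sub_cancel_right]
      conv_lhs => rw [hxupd k]
      abel
    · have e : Kt (y k - ystar) + (G' (x (k + 1)) - G' xstar) = Kt (y k) + G' (x (k + 1)) := by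
        rw [hGs]; simp only [map_sub]; abel
      have e2 : h k - K xstar - K (x (k + 1) - xstar) = h k - K (x (k + 1)) := by
        rw [map_sub]; abel
      rw [e, e2]
      conv_lhs => rw [hyupd k]
      abel
    · exact apda_coco G G' hgrad μx hμx hsc Lx hLx hsmooth _ _
    · have h1 := hh k ystar
      have h2 := hopty (y (k + 1))
      rw [← neg_sub (y (k + 1)) ystar, inner_neg_right] at h1
      rw [inner_sub_left]
      linarith
    · exact hKt (y k)
  have hrec : ∀ k, Δ (k + 1) ≤ θ * Δ k := by
    intro k
    cases k with
    | zero =>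
      have := hstep 0 0 (by simp [hybar0])
      rw [hΔ0]
      simpa using this
    | succ k =>
      have := hstep (k + 1) (y (k + 1) - y k) (hybarupd k)
      rw [hΔ k, ← map_sub]
      exact this
  intro k
  constructor
  · rw [hΔ k, ← map_sub]
    have c1 := apda_young (Kt (y (k + 1) - y k)) (-(x (k + 1) - xstar)) ηx hx0
    rw [inner_neg_right, norm_neg] at c1
    have c2 : ηx * ‖Kt (y (k + 1) - y k)‖ ^ 2 ≤ 1 / (2 * ηy) * ‖y (k + 1) - y k‖ ^ 2 := by
      calc ηx * ‖Kt (y (k + 1) - y k)‖ ^ 2 ≤ ηx * (Lxy * ‖y (k + 1) - y k‖) ^ 2 := by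
            gcongr; exact hKtL _
        _ = ηx * Lxy ^ 2 * ‖y (k + 1) - y k‖ ^ 2 := by ring
        _ = _ := by rw [hprod]
    have d1 : (1 + μx * ηx) * (1 / ηx) * ‖x (k + 1) - xstar‖ ^ 2
        = 1 / ηx * ‖x (k + 1) - xstar‖ ^ 2 + μx * ‖x (k + 1) - xstar‖ ^ 2 := by
      field_simp
    linarith
  · induction k with
    | zero => simp
    | succ k ih =>
      calc Δ (k + 1) ≤ θ * Δ k := hrec k
        _ ≤ θ * (θ ^ k * Δ 0) := by gcongr
        _ = _ := by ring
end

section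
/- (Inexact-prox primal descent, Lemma 18.) Let G be differentiable, μ_x-strongly convex and L_x-smooth, and suppose ∇G(x*) + K^⊤y* = 0. Let η_x > 0, x^k ∈ E_x, ȳ ∈ E_y, and define Ψ(u) := G(u) + (1/(2η_x))‖u − (x^k − η_x K^⊤ ȳ)‖², with gradient ∇Ψ(u) = ∇G(u) + K^⊤ ȳ + (1/η_x)(u − x^k), and let w* be the (unique) minimizer of Ψ. Let x̂ ∈ E_x be arbitrary and set x^{k+1} := x^k − η_x(∇G(x̂) + K^⊤ ȳ). Then (1 + μ_xη_x/2)(1/η_x)‖x^{k+1} − x*‖² ≤ (1/η_x)‖x^k − x*‖² + (2η_x + μ_xη_x²)‖∇Ψ(x̂)‖² − (1/(2η_x))‖x^k − w*‖² − 2⟨K^⊤ ȳ − K^⊤ y*, x̂ − x*⟩ − (1/L_x)‖∇G(x̂) − ∇G(x*)‖². -/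
open RealInnerProductSpace

lemma aux_descent {E : Type*} [NormedAddCommGroup E] [InnerProductSpace ℝ E] [FiniteDimensional ℝ E]
    (G : E → ℝ) (G' : E → E) (hgrad : ∀ u, HasGradientAt G (G' u) u)
    (L : ℝ) (hsmooth : ∀ u v, ‖G' u - G' v‖ ≤ L * ‖u - v‖) (u v : E) :
    G v ≤ G u + ⟪G' u, v - u⟫ + L / 2 * ‖v - u‖ ^ 2 := by
  have hd : ∀ t : ℝ, HasDerivAt (fun t : ℝ => G (u + t • (v - u)) - t * ⟪G' u, v - u⟫
      - L / 2 * ‖v - u‖ ^ 2 * t ^ 2)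
      (⟪G' (u + t • (v - u)), v - u⟫ - ⟪G' u, v - u⟫ - L / 2 * ‖v - u‖ ^ 2 * (2 * t)) t := by
    intro t
    have h1 : HasDerivAt (fun t : ℝ => u + t • (v - u)) (v - u) t := by
      simpa using ((hasDerivAt_id t).smul_const (v - u)).const_add u
    have h2 := (hgrad (u + t • (v - u))).hasFDerivAt.comp_hasDerivAt t h1
    have h3 : HasDerivAt (fun t : ℝ => t * ⟪G' u, v - u⟫) ⟪G' u, v - u⟫ t := by
      simpa using (hasDerivAt_id t).mul_const ⟪G' u, v - u⟫
    have h4 : HasDerivAt (fun t : ℝ => L / 2 * ‖v - u‖ ^ 2 * t ^ 2)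
        (L / 2 * ‖v - u‖ ^ 2 * (2 * t)) t := by
      simpa using (hasDerivAt_pow 2 t).const_mul (L / 2 * ‖v - u‖ ^ 2)
    have h5 := (h2.sub h3).sub h4
    simp at h5
    exact h5
  have hanti := antitoneOn_of_deriv_nonpos (convex_Icc (0 : ℝ) 1)
    (fun t _ => (hd t).continuousAt.continuousWithinAt)
    (fun t _ => (hd t).differentiableAt.differentiableWithinAt)
    (by
      intro t ht
      rw [interior_Icc] at ht
      rw [(hd t).deriv]
      have h1 := hsmooth (u + t • (v - u)) u
      rw [add_sub_cancel_left, norm_smul, Real.norm_of_nonneg ht.1.le] at h1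
      have h2 := real_inner_le_norm (G' (u + t • (v - u)) - G' u) (v - u)
      rw [inner_sub_left] at h2
      have h3 := mul_le_mul_of_nonneg_right h1 (norm_nonneg (v - u))
      nlinarith)
  have := hanti (Set.left_mem_Icc.2 zero_le_one) (Set.right_mem_Icc.2 zero_le_one) zero_le_one
  simp at this
  linarith

lemma aux_coco {E : Type*} [NormedAddCommGroup E] [InnerProductSpace ℝ E] [FiniteDimensional ℝ E]
    (G : E → ℝ) (G' : E → E) (hgrad : ∀ u, HasGradientAt G (G' u) u)
    (hc : ∀ u v, G u + ⟪G' u, v - u⟫ ≤ G v)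
    (L : ℝ) (hL : 0 < L) (hsmooth : ∀ u v, ‖G' u - G' v‖ ≤ L * ‖u - v‖) (u v : E) :
    G u + ⟪G' u, v - u⟫ + 1 / (2 * L) * ‖G' v - G' u‖ ^ 2 ≤ G v := by
  have h1 := hc u (v - (1 / L) • (G' v - G' u))
  have h2 := aux_descent G G' hgrad L hsmooth v (v - (1 / L) • (G' v - G' u))
  have e1 : v - (1 / L) • (G' v - G' u) - u = (v - u) - (1 / L) • (G' v - G' u) := by abel
  have e2 : v - (1 / L) • (G' v - G' u) - v = - ((1 / L) • (G' v - G' u)) := by abel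
  rw [e1, inner_sub_right, inner_smul_right] at h1
  rw [e2, inner_neg_right, inner_smul_right, norm_neg, norm_smul, mul_pow,
    Real.norm_of_nonneg (by positivity : (0:ℝ) ≤ 1 / L)] at h2
  have h3 : ⟪G' v, G' v - G' u⟫ - ⟪G' u, G' v - G' u⟫ = ‖G' v - G' u‖ ^ 2 := by
    rw [← inner_sub_left, real_inner_self_eq_norm_sq]
  have h4 : L / 2 * ((1 / L) ^ 2 * ‖G' v - G' u‖ ^ 2) = 1 / (2 * L) * ‖G' v - G' u‖ ^ 2 := by
    field_simp
  have h5 : 1 / L * ⟪G' v, G' v - G' u⟫ - 1 / L * ⟪G' u, G' v - G' u⟫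
      = 2 * (1 / (2 * L) * ‖G' v - G' u‖ ^ 2) := by
    rw [← mul_sub, h3]; field_simp
  linarith

/-- Inexact-prox primal descent (Lemma 18). -/
theorem inexact_prox_primal_descent
    {Ex Ey : Type*}
    [NormedAddCommGroup Ex] [InnerProductSpace ℝ Ex] [FiniteDimensional ℝ Ex]
    [NormedAddCommGroup Ey] [InnerProductSpace ℝ Ey] [FiniteDimensional ℝ Ey]
    (K : Ex →ₗ[ℝ] Ey) (Kt : Ey →ₗ[ℝ] Ex)
    (hadj : ∀ (x : Ex) (y : Ey), ⟪K x, y⟫ = ⟪x, Kt y⟫)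
    (G : Ex → ℝ) (G' : Ex → Ex)
    (hgrad : ∀ u, HasGradientAt G (G' u) u)
    (μx : ℝ) (hμx : 0 < μx)
    (hsc : ∀ u v, G u + ⟪G' u, v - u⟫ + μx / 2 * ‖v - u‖ ^ 2 ≤ G v)
    (Lx : ℝ) (hLx : 0 < Lx)
    (hsmooth : ∀ u v, ‖G' u - G' v‖ ≤ Lx * ‖u - v‖)
    (xstar : Ex) (ystar : Ey)
    (hopt : G' xstar + Kt ystar = 0)
    (ηx : ℝ) (hηx : 0 < ηx)
    (xk : Ex) (ybar : Ey)
    (Ψ : Ex → ℝ)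
    (hΨ : ∀ u, Ψ u = G u + (1 / (2 * ηx)) * ‖u - (xk - ηx • Kt ybar)‖ ^ 2)
    (Ψ' : Ex → Ex)
    (hΨ' : ∀ u, Ψ' u = G' u + Kt ybar + (1 / ηx) • (u - xk))
    (wstar : Ex) (hwstar : ∀ u, Ψ wstar ≤ Ψ u)
    (xhat : Ex) (xkp1 : Ex)
    (hupd : xkp1 = xk - ηx • (G' xhat + Kt ybar)) :
    (1 + μx * ηx / 2) * (1 / ηx) * ‖xkp1 - xstar‖ ^ 2 ≤
      (1 / ηx) * ‖xk - xstar‖ ^ 2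
        + (2 * ηx + μx * ηx ^ 2) * ‖Ψ' xhat‖ ^ 2
        - (1 / (2 * ηx)) * ‖xk - wstar‖ ^ 2
        - 2 * ⟪Kt ybar - Kt ystar, xhat - xstar⟫
        - (1 / Lx) * ‖G' xhat - G' xstar‖ ^ 2 := by
  have hmono : ∀ u v, μx * ‖u - v‖ ^ 2 ≤ ⟪G' u - G' v, u - v⟫ := by
    intro u v
    have h1 := hsc u v
    have h2 := hsc v u
    rw [← neg_sub u v, inner_neg_right, norm_neg] at h1
    rw [inner_sub_left]
    linarith
  have hcoco : 1 / Lx * ‖G' xhat - G' xstar‖ ^ 2 ≤ ⟪G' xhat - G' xstar, xhat - xstar⟫ := by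
    have hc : ∀ u v, G u + ⟪G' u, v - u⟫ ≤ G v := fun u v => by
      have := hsc u v
      have : 0 ≤ μx / 2 * ‖v - u‖ ^ 2 := by positivity
      linarith
    have h1 := aux_coco G G' hgrad hc Lx hLx hsmooth xhat xstar
    have h2 := aux_coco G G' hgrad hc Lx hLx hsmooth xstar xhat
    rw [← neg_sub xhat xstar, inner_neg_right, ← neg_sub (G' xhat) (G' xstar), norm_neg] at h1
    have h3 : 1 / Lx * ‖G' xhat - G' xstar‖ ^ 2
      = 2 * (1 / (2 * Lx) * ‖G' xhat - G' xstar‖ ^ 2) := by field_simp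
    rw [inner_sub_left]
    linarith
  -- stationarity
  have hw0 : Ψ' wstar = 0 := by
    have hΨf : Ψ = fun u => G u + (1 / (2 * ηx)) * ‖u - (xk - ηx • Kt ybar)‖ ^ 2 := funext hΨ
    have hmin : IsLocalMin Ψ wstar := Filter.Eventually.of_forall hwstar
    have hq := ((((hasFDerivAt_id (𝕜 := ℝ) wstar).sub_const (xk - ηx • Kt ybar)).norm_sq).const_mul
      (1 / (2 * ηx)))
    have hd := (hgrad wstar).hasFDerivAt.add hq
    have hz := hmin.hasFDerivAt_eq_zero (by rw [hΨf]; exact hd)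
    have hz2 := congrArg (fun f => f (Ψ' wstar)) hz
    simp at hz2
    rw [← inner_self_eq_zero (𝕜 := ℝ)]
    nth_rewrite 1 [hΨ' wstar]
    rw [← hz2]
    simp only [inner_add_left, inner_sub_left, real_inner_smul_left]
    field_simp
    ring
  set e := Ψ' xhat with he
  have hxk : xkp1 = xhat - ηx • e := by
    rw [hupd, he, hΨ', smul_add ηx (_ + _), smul_smul, mul_one_div_cancel hηx.ne', one_smul]
    abel
  have hdist : ‖xhat - wstar‖ ^ 2 ≤ ηx ^ 2 * ‖e‖ ^ 2 := by
    have h1 := hmono xhat wstar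
    have h2 : e = (G' xhat - G' wstar) + (1 / ηx) • (xhat - wstar) := by
      rw [← sub_zero e, ← hw0, he, hΨ', hΨ']
      simp only [smul_sub]; abel
    have h3 : 1 / ηx * ‖xhat - wstar‖ ^ 2 ≤ ⟪e, xhat - wstar⟫ := by
      rw [h2, inner_add_left, real_inner_smul_left, real_inner_self_eq_norm_sq]
      have : 0 ≤ μx * ‖xhat - wstar‖ ^ 2 := by positivity
      linarith
    have h4 := real_inner_le_norm e (xhat - wstar)
    have h5 : ‖xhat - wstar‖ ^ 2 ≤ ηx * (‖e‖ * ‖xhat - wstar‖) := by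
      have := mul_le_mul_of_nonneg_left (h3.trans h4) hηx.le
      rwa [← mul_assoc, mul_one_div_cancel hηx.ne', one_mul] at this
    nlinarith [sq_nonneg (‖xhat - wstar‖ - ηx * ‖e‖)]
  have hpar : ∀ a b : Ex, ‖a + b‖ ^ 2 ≤ 2 * ‖a‖ ^ 2 + 2 * ‖b‖ ^ 2 := by
    intro a b
    have := parallelogram_law_with_norm ℝ a b
    nlinarith [sq_nonneg ‖a - b‖]
  have hA : ‖xk - wstar‖ ^ 2 ≤ 2 * ‖xk - xhat‖ ^ 2 + 2 * (ηx ^ 2 * ‖e‖ ^ 2) := by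
    have := hpar (xk - xhat) (xhat - wstar)
    rw [sub_add_sub_cancel] at this
    linarith
  have hB : ‖xkp1 - xstar‖ ^ 2 ≤ 2 * ‖xhat - xstar‖ ^ 2 + 2 * (ηx ^ 2 * ‖e‖ ^ 2) := by
    have := hpar (xhat - xstar) (-(ηx • e))
    rw [norm_neg, norm_smul ηx, mul_pow, Real.norm_of_nonneg hηx.le] at this
    have h : xkp1 - xstar = xhat - xstar + -(ηx • e) := by rw [hxk]; abel
    rw [h]; exact this
  have hM := hmono xhat xstar
  -- key identity
  have hkey : ‖xk - xstar‖ ^ 2 - ‖xkp1 - xstar‖ ^ 2 =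
      2 * ηx * (⟪G' xhat - G' xstar, xhat - xstar⟫ + ⟪Kt ybar - Kt ystar, xhat - xstar⟫)
      + ‖xk - xhat‖ ^ 2 - ηx ^ 2 * ‖e‖ ^ 2 := by
    have hs : G' xstar = - Kt ystar := eq_neg_of_add_eq_zero_left hopt
    have e0 : (G' xhat - G' xstar) + (Kt ybar - Kt ystar) = e - (1 / ηx) • (xhat - xk) := by
      rw [hs, he, hΨ']; abel
    rw [← inner_add_left, e0, inner_sub_left, real_inner_smul_left]
    have e1 : xk - xstar = (xhat - xstar) - (xhat - xk) := by abel
    have e2 : xkp1 - xstar = (xhat - xstar) - ηx • e := by rw [hxk]; abel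
    rw [e1, e2, norm_sub_sq_real (xhat - xstar) (xhat - xk), norm_sub_sq_real (xhat - xstar) (ηx • e), norm_smul, mul_pow,
      Real.norm_of_nonneg hηx.le, real_inner_smul_right, norm_sub_rev xk xhat,
      real_inner_comm e (xhat - xstar), real_inner_comm (xhat - xk) (xhat - xstar)]
    field_simp
    ring
  have hk2 : 1 / ηx * ‖xk - xstar‖ ^ 2 - 1 / ηx * ‖xkp1 - xstar‖ ^ 2 =
      2 * (⟪G' xhat - G' xstar, xhat - xstar⟫ + ⟪Kt ybar - Kt ystar, xhat - xstar⟫)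
      + 1 / ηx * ‖xk - xhat‖ ^ 2 - ηx * ‖e‖ ^ 2 := by
    rw [← mul_sub, hkey]; field_simp
  have hA2 : 1 / (2 * ηx) * ‖xk - wstar‖ ^ 2 ≤ 1 / ηx * ‖xk - xhat‖ ^ 2 + ηx * ‖e‖ ^ 2 := by
    have := mul_le_mul_of_nonneg_left hA (by positivity : 0 ≤ 1 / (2 * ηx))
    refine this.trans (le_of_eq ?_)
    field_simp
  have hB2 := mul_le_mul_of_nonneg_left hB (by positivity : 0 ≤ μx / 2)
  have hl : (1 + μx * ηx / 2) * (1 / ηx) * ‖xkp1 - xstar‖ ^ 2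
      = 1 / ηx * ‖xkp1 - xstar‖ ^ 2 + μx / 2 * ‖xkp1 - xstar‖ ^ 2 := by field_simp
  rw [hl]
  linarith
end

section
/- (Inexact-prox inner-product bound, Lemma 20.) Let L_xy > 0 satisfy ‖K x‖ ≤ L_xy‖x‖ for all x ∈ E_x. Let θ ≥ 0, η_x > 0, let y^k, y^{k−1} ∈ E_y and x̂^k, x̂^{k−1}, x^k, w ∈ E_x, and let v ∈ E_x satisfy x^k = x̂^{k−1} − η_x v (in the paper, v = ∇Ψ^{k−1}(x̂^{k−1}) and w = w*^k is the minimizer of the auxiliary function Ψ^k). Then −2θ⟨K^⊤(y^k − y^{k−1}), x̂^k − x̂^{k−1}⟩ ≤ 16 L_xy² θ η_x ‖y^k − y^{k−1}‖² + (θ/(4η_x))‖x̂^k − w‖² + (θ/(4η_x))‖x^k − w‖² + (θ η_x / 8)‖v‖². -/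
open RealInnerProductSpace

/-- Inexact-prox inner-product bound (Lemma 20). -/
theorem inexact_prox_inner_product_bound
    {Ex Ey : Type*}
    [NormedAddCommGroup Ex] [InnerProductSpace ℝ Ex] [FiniteDimensional ℝ Ex]
    [NormedAddCommGroup Ey] [InnerProductSpace ℝ Ey] [FiniteDimensional ℝ Ey]
    (K : Ex →ₗ[ℝ] Ey) (Kt : Ey →ₗ[ℝ] Ex)
    (hadj : ∀ (x : Ex) (y : Ey), ⟪K x, y⟫ = ⟪x, Kt y⟫)
    (Lxy : ℝ) (hLxy : 0 < Lxy) (hK : ∀ x : Ex, ‖K x‖ ≤ Lxy * ‖x‖)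
    (θ ηx : ℝ) (hθ : 0 ≤ θ) (hηx : 0 < ηx)
    (yk ykm1 : Ey) (xhatk xhatkm1 xk w v : Ex)
    (hv : xk = xhatkm1 - ηx • v) :
    -2 * θ * ⟪Kt (yk - ykm1), xhatk - xhatkm1⟫ ≤
      16 * Lxy ^ 2 * θ * ηx * ‖yk - ykm1‖ ^ 2
        + (θ / (4 * ηx)) * ‖xhatk - w‖ ^ 2
        + (θ / (4 * ηx)) * ‖xk - w‖ ^ 2
        + (θ * ηx / 8) * ‖v‖ ^ 2 := by
  have h1 : -⟪Kt (yk - ykm1), xhatk - xhatkm1⟫ ≤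
      Lxy * ‖xhatk - xhatkm1‖ * ‖yk - ykm1‖ := by
    rw [real_inner_comm, ← hadj]
    have h := abs_real_inner_le_norm (K (xhatk - xhatkm1)) (yk - ykm1)
    have h' := mul_le_mul_of_nonneg_right (hK (xhatk - xhatkm1)) (norm_nonneg (yk - ykm1))
    linarith [neg_abs_le ⟪K (xhatk - xhatkm1), yk - ykm1⟫]
  have h2 : ‖xhatk - xhatkm1‖ ≤ ‖xhatk - w‖ + ‖xk - w‖ + ηx * ‖v‖ := by
    have e : xhatk - xhatkm1 = (xhatk - w) - (xk - w) - ηx • v := by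
      rw [hv]; abel
    have n : ‖ηx • v‖ = ηx * ‖v‖ := by
      rw [norm_smul, Real.norm_of_nonneg hηx.le]
    rw [e, ← n]
    exact (norm_sub_le _ _).trans (by gcongr; exact norm_sub_le _ _)
  generalize ‖xhatk - xhatkm1‖ = N at *
  generalize ⟪Kt (yk - ykm1), xhatk - xhatkm1⟫ = I at *
  have hD := norm_nonneg (yk - ykm1)
  generalize ‖yk - ykm1‖ = D at *
  generalize ‖xhatk - w‖ = a at *
  generalize ‖xk - w‖ = b at *
  generalize ‖v‖ = c at *
  have h3 : -I ≤ Lxy * (a + b + ηx * c) * D := h1.trans (by gcongr)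
  have key : ∀ t : ℝ, 2 * (Lxy * t * D) ≤ 4 * Lxy ^ 2 * ηx * D ^ 2 + t ^ 2 / (4 * ηx) := by
    intro t
    have e : 4 * Lxy ^ 2 * ηx * D ^ 2 + t ^ 2 / (4 * ηx) - 2 * (Lxy * t * D)
        = (4 * ηx * Lxy * D - t) ^ 2 / (4 * ηx) := by
      field_simp
      ring
    have : 0 ≤ (4 * ηx * Lxy * D - t) ^ 2 / (4 * ηx) := by positivity
    linarith
  have kc : 2 * (Lxy * (ηx * c) * D) ≤ 8 * Lxy ^ 2 * ηx * D ^ 2 + ηx * c ^ 2 / 8 := by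
    nlinarith [mul_nonneg hηx.le (sq_nonneg (8 * Lxy * D - c))]
  have tot : -2 * I ≤ 16 * Lxy ^ 2 * ηx * D ^ 2 + a ^ 2 / (4 * ηx) + b ^ 2 / (4 * ηx)
      + ηx * c ^ 2 / 8 := by
    linarith [key a, key b]
  calc -2 * θ * I = θ * (-2 * I) := by ring
    _ ≤ _ := mul_le_mul_of_nonneg_left tot hθ
    _ = _ := by ring
end

section
/- (Lemma 1(i): gradient-norm rate of Gradient Descent.) Let f : E → ℝ be convex, differentiable with gradient ∇f, and L-smooth (L > 0), and let x* be a minimizer of f. Let K ≥ 1 be a natural number and define iterates by x^{j+1} = x^j − (1/L)∇f(x^j) for j = 0, 1, …, 2K−1, starting from any x^0 ∈ E. Then ‖∇f(x^{2K})‖² ≤ L²‖x^0 − x*‖² / K². -/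
open RealInnerProductSpace

section helpers
variable {E : Type*} [NormedAddCommGroup E] [InnerProductSpace ℝ E] [FiniteDimensional ℝ E]

lemma gd_line (f : E → ℝ) (f' : E → E) (hgrad : ∀ u, HasGradientAt f (f' u) u) (u d : E) (t : ℝ) :
    HasDerivAt (fun t : ℝ => f (u + t • d)) ⟪f' (u + t • d), d⟫ t := by
  have h1 := (hgrad (u + t • d)).hasFDerivAt
  have h2 : HasDerivAt (fun t : ℝ => u + t • d) d t := by
    simpa using ((hasDerivAt_id t).smul_const d).const_add u
  have h3 := h1.comp_hasDerivAt t h2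
  simp only [InnerProductSpace.toDual_apply_apply] at h3
  exact h3

lemma gd_descent (f : E → ℝ) (f' : E → E) (hgrad : ∀ u, HasGradientAt f (f' u) u)
    (L : ℝ) (hsmooth : ∀ u v, ‖f' u - f' v‖ ≤ L * ‖u - v‖) (u d : E) :
    f (u + d) ≤ f u + ⟪f' u, d⟫ + L / 2 * ‖d‖ ^ 2 := by
  have hd : ∀ t : ℝ, HasDerivAt
      (fun t : ℝ => f (u + t • d) - t * ⟪f' u, d⟫ - t ^ 2 * (L / 2 * ‖d‖ ^ 2))
      (⟪f' (u + t • d), d⟫ - ⟪f' u, d⟫ - 2 * t * (L / 2 * ‖d‖ ^ 2)) t := by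
    intro t
    have h1 := (hasDerivAt_id t).mul_const ⟪f' u, d⟫
    have h2 := (hasDerivAt_pow 2 t).mul_const (L / 2 * ‖d‖ ^ 2)
    have h3 := ((gd_line f f' hgrad u d t).sub h1).sub h2
    simp only [one_mul, Nat.cast_ofNat, Nat.add_one_sub_one, pow_one] at h3
    exact h3
  have hanti := antitoneOn_of_deriv_nonpos (convex_Icc (0:ℝ) 1)
    (fun t _ => (hd t).continuousAt.continuousWithinAt)
    (fun t _ => (hd t).differentiableAt.differentiableWithinAt)
    (by
      intro t ht
      rw [interior_Icc] at ht
      rw [(hd t).deriv, ← inner_sub_left]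
      have h1 := real_inner_le_norm (f' (u + t • d) - f' u) d
      have h2 := hsmooth (u + t • d) u
      rw [add_sub_cancel_left, norm_smul, Real.norm_of_nonneg ht.1.le] at h2
      have h3 := mul_le_mul_of_nonneg_right h2 (norm_nonneg d)
      nlinarith)
  have := hanti (Set.left_mem_Icc.2 zero_le_one) (Set.right_mem_Icc.2 zero_le_one) zero_le_one
  simp at this
  linarith

lemma gd_convex (f : E → ℝ) (f' : E → E) (hgrad : ∀ u, HasGradientAt f (f' u) u)
    (hconv : ConvexOn ℝ Set.univ f) (u v : E) :
    f u + ⟪f' u, v - u⟫ ≤ f v := by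
  have hc : ConvexOn ℝ Set.univ (fun t : ℝ => f (u + t • (v - u))) := by
    have := hconv.comp_affineMap (AffineMap.lineMap u v : ℝ →ᵃ[ℝ] E)
    have e : (fun t : ℝ => f (u + t • (v - u))) = f ∘ (AffineMap.lineMap u v : ℝ →ᵃ[ℝ] E) := by
      funext t
      simp [AffineMap.lineMap_apply, add_comm]
    rw [e]
    exact this
  have h := hc.le_slope_of_hasDerivAt (Set.mem_univ 0) (Set.mem_univ 1) zero_lt_one
    (gd_line f f' hgrad u (v - u) 0)
  simp [slope] at h
  linarith

lemma gd_coco (f : E → ℝ) (f' : E → E) (hgrad : ∀ u, HasGradientAt f (f' u) u)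
    (hconv : ConvexOn ℝ Set.univ f)
    (L : ℝ) (hL : 0 < L) (hsmooth : ∀ u v, ‖f' u - f' v‖ ≤ L * ‖u - v‖) (u v : E) :
    f u + ⟪f' u, v - u⟫ + 1 / (2 * L) * ‖f' v - f' u‖ ^ 2 ≤ f v := by
  have h1 := gd_descent f f' hgrad L hsmooth v (-((1 / L) • (f' v - f' u)))
  have h2 := gd_convex f f' hgrad hconv u (v + -((1 / L) • (f' v - f' u)))
  have e : v + -((1 / L) • (f' v - f' u)) - u = (v - u) - (1 / L) • (f' v - f' u) := by abel
  rw [e, inner_sub_right, inner_smul_right] at h2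
  rw [inner_neg_right, inner_smul_right, norm_neg, norm_smul, mul_pow,
    Real.norm_of_nonneg (by positivity)] at h1
  have h3 : ⟪f' v, f' v - f' u⟫ - ⟪f' u, f' v - f' u⟫ = ‖f' v - f' u‖ ^ 2 := by
    rw [← inner_sub_left, real_inner_self_eq_norm_sq]
  have h4 : L / 2 * ((1 / L) ^ 2 * ‖f' v - f' u‖ ^ 2) = 1 / (2 * L) * ‖f' v - f' u‖ ^ 2 := by
    field_simp
  have h5 : 1 / L * ‖f' v - f' u‖ ^ 2 = 2 * (1 / (2 * L) * ‖f' v - f' u‖ ^ 2) := by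
    field_simp
  have h6 := congrArg (fun z => 1 / L * z) h3
  simp only [mul_sub] at h6
  linarith

lemma gd_step (f : E → ℝ) (f' : E → E) (hgrad : ∀ u, HasGradientAt f (f' u) u)
    (L : ℝ) (hL : 0 < L) (hsmooth : ∀ u v, ‖f' u - f' v‖ ≤ L * ‖u - v‖) (u v : E)
    (hv : v = u - (1 / L) • f' u) :
    f v + 1 / (2 * L) * ‖f' u‖ ^ 2 ≤ f u := by
  have h1 := gd_descent f f' hgrad L hsmooth u (-((1 / L) • f' u))
  rw [← sub_eq_add_neg, ← hv, inner_neg_right, inner_smul_right, norm_neg, norm_smul, mul_pow,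
    Real.norm_of_nonneg (by positivity), real_inner_self_eq_norm_sq] at h1
  have h4 : L / 2 * ((1 / L) ^ 2 * ‖f' u‖ ^ 2) = 1 / (2 * L) * ‖f' u‖ ^ 2 := by
    field_simp
  have h5 : 1 / L * ‖f' u‖ ^ 2 = 2 * (1 / (2 * L) * ‖f' u‖ ^ 2) := by
    field_simp
  linarith

lemma gd_mono (f : E → ℝ) (f' : E → E) (hgrad : ∀ u, HasGradientAt f (f' u) u)
    (hconv : ConvexOn ℝ Set.univ f)
    (L : ℝ) (hL : 0 < L) (hsmooth : ∀ u v, ‖f' u - f' v‖ ≤ L * ‖u - v‖) (u v : E)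
    (hv : v = u - (1 / L) • f' u) :
    ‖f' v‖ ^ 2 ≤ ‖f' u‖ ^ 2 := by
  have h1 := gd_coco f f' hgrad hconv L hL hsmooth u v
  have h2 := gd_coco f f' hgrad hconv L hL hsmooth v u
  have e1 : v - u = -((1 / L) • f' u) := by rw [hv]; abel
  have e2 : u - v = (1 / L) • f' u := by rw [hv]; abel
  rw [e1, inner_neg_right, inner_smul_right, real_inner_self_eq_norm_sq] at h1
  rw [e2, inner_smul_right, norm_sub_rev] at h2
  have h3 := norm_sub_sq_real (f' v) (f' u)
  have h6 : 1 / L * (⟪f' v, f' u⟫ + ‖f' v - f' u‖ ^ 2 - ‖f' u‖ ^ 2) ≤ 0 := by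
    have : 1 / L * ‖f' v - f' u‖ ^ 2 = 2 * (1 / (2 * L) * ‖f' v - f' u‖ ^ 2) := by field_simp
    linarith
  have h7 := nonpos_of_mul_nonpos_right h6 (by positivity)
  nlinarith [sq_nonneg ‖f' v - f' u‖]

end helpers

/-- Lemma 1(i): gradient-norm rate of Gradient Descent. -/
theorem gd_gradient_norm_rate
    {E : Type*} [NormedAddCommGroup E] [InnerProductSpace ℝ E] [FiniteDimensional ℝ E]
    (f : E → ℝ) (f' : E → E)
    (hgrad : ∀ u, HasGradientAt f (f' u) u)
    (hconv : ConvexOn ℝ Set.univ f)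
    (L : ℝ) (hL : 0 < L)
    (hsmooth : ∀ u v, ‖f' u - f' v‖ ≤ L * ‖u - v‖)
    (xstar : E) (hmin : ∀ u, f xstar ≤ f u)
    (K : ℕ) (hK : 1 ≤ K)
    (x : ℕ → E)
    (hupd : ∀ j < 2 * K, x (j + 1) = x j - (1 / L) • f' (x j)) :
    ‖f' (x (2 * K))‖ ^ 2 ≤ L ^ 2 * ‖x 0 - xstar‖ ^ 2 / (K : ℝ) ^ 2 := by
  have key1 : ∀ n : ℕ, n ≤ 2 * K → n * (f (x n) - f xstar) + L / 2 * ‖x n - xstar‖ ^ 2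
      ≤ L / 2 * ‖x 0 - xstar‖ ^ 2 := by
    intro n
    induction n with
    | zero => intro _; simp
    | succ n ih =>
      intro hn
      have ih := ih (by omega)
      have hu := hupd n (by omega)
      have h1 := gd_step f f' hgrad L hL hsmooth _ _ hu
      have h2 := gd_convex f f' hgrad hconv (x n) xstar
      have e : x (n + 1) - xstar = (x n - xstar) - (1 / L) • f' (x n) := by rw [hu]; abel
      have h3 := norm_sub_sq_real (x n - xstar) ((1 / L) • f' (x n))
      rw [← e, inner_smul_right, norm_smul, mul_pow, Real.norm_of_nonneg (by positivity),
        real_inner_comm] at h3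
      rw [← neg_sub, inner_neg_right] at h2
      have h4 : L / 2 * ‖x (n + 1) - xstar‖ ^ 2 = L / 2 * ‖x n - xstar‖ ^ 2
          - ⟪f' (x n), x n - xstar⟫ + 1 / (2 * L) * ‖f' (x n)‖ ^ 2 := by
        rw [h3]; field_simp
      have h5 : f (x (n + 1)) - f xstar ≤ f (x n) - f xstar := by
        have : 0 ≤ 1 / (2 * L) * ‖f' (x n)‖ ^ 2 := by positivity
        linarith
      have h6 := mul_le_mul_of_nonneg_left h5 (Nat.cast_nonneg (α := ℝ) n)
      push_cast
      linarith
  have key2 : ∀ m : ℕ, m ≤ K → m * (1 / (2 * L) * ‖f' (x (K + m))‖ ^ 2) + f (x (K + m))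
      ≤ f (x K) := by
    intro m
    induction m with
    | zero => intro _; simp
    | succ m ih =>
      intro hm
      have ih := ih (by omega)
      have hu := hupd (K + m) (by omega)
      have h1 := gd_step f f' hgrad L hL hsmooth _ _ hu
      have h2 := gd_mono f f' hgrad hconv L hL hsmooth _ _ hu
      have h3 : 1 / (2 * L) * ‖f' (x (K + m + 1))‖ ^ 2 ≤ 1 / (2 * L) * ‖f' (x (K + m))‖ ^ 2 :=
        mul_le_mul_of_nonneg_left h2 (by positivity)
      have h6 := mul_le_mul_of_nonneg_left h3 (Nat.cast_nonneg (α := ℝ) m)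
      rw [← add_assoc]
      push_cast
      linarith
  have a1 := key1 K (by omega)
  have a2 := key2 K le_rfl
  rw [← two_mul] at a2
  have hKpos : (0 : ℝ) < K := by exact_mod_cast hK
  have a3 : (K : ℝ) * (1 / (2 * L) * ‖f' (x (2 * K))‖ ^ 2) ≤ f (x K) - f xstar := by
    linarith [hmin (x (2 * K))]
  have a4 := mul_le_mul_of_nonneg_left a3 hKpos.le
  have a5 : 0 ≤ L / 2 * ‖x K - xstar‖ ^ 2 := by positivity
  have a6 : (K : ℝ) * (K * (1 / (2 * L) * ‖f' (x (2 * K))‖ ^ 2)) ≤ L / 2 * ‖x 0 - xstar‖ ^ 2 := by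
    linarith
  have a7 := mul_le_mul_of_nonneg_left a6 (show 0 ≤ 2 * L by positivity)
  rw [le_div_iff₀ (by positivity)]
  have a8 : 2 * L * ((K : ℝ) * (K * (1 / (2 * L) * ‖f' (x (2 * K))‖ ^ 2)))
      = ‖f' (x (2 * K))‖ ^ 2 * (K : ℝ) ^ 2 := by field_simp
  linarith
end

section
/- (Monotone decrease of gradient norm under Gradient Descent; claim in the proof of Lemma 1.) Let f : E → ℝ be convex, differentiable with gradient ∇f, and L-smooth (L > 0). Let γ > 0 satisfy γ ≤ 2/L, let x ∈ E, and set x' := x − γ∇f(x). Then ‖∇f(x')‖ ≤ ‖∇f(x)‖. -/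
open RealInnerProductSpace

lemma aux_line {E : Type*} [NormedAddCommGroup E] [InnerProductSpace ℝ E]
    [FiniteDimensional ℝ E] (f : E → ℝ) (f' : E → E)
    (hgrad : ∀ u, HasGradientAt f (f' u) u) (u w : E) (t : ℝ) :
    HasDerivAt (fun t : ℝ => f (u + t • w)) (inner ℝ (f' (u + t • w)) w) t := by
  have h1 : HasDerivAt (fun t : ℝ => u + t • w) w t := by
    simpa using ((hasDerivAt_id t).smul_const w).const_add u
  have h2 := (hgrad (u + t • w)).hasFDerivAt.comp_hasDerivAt t h1
  simp at h2
  exact h2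

lemma aux_lower {E : Type*} [NormedAddCommGroup E] [InnerProductSpace ℝ E]
    [FiniteDimensional ℝ E] (f : E → ℝ) (f' : E → E)
    (hgrad : ∀ u, HasGradientAt f (f' u) u)
    (hconv : ConvexOn ℝ Set.univ f) (u w : E) :
    f u + inner ℝ (f' u) w ≤ f (u + w) := by
  have hc : ConvexOn ℝ Set.univ (fun t : ℝ => f (u + t • w)) := by
    refine ⟨convex_univ, fun a _ b _ p q hp hq hpq => ?_⟩
    have := hconv.2 (Set.mem_univ (u + a • w)) (Set.mem_univ (u + b • w)) hp hq hpq
    have e : u + (p • a + q • b) • w = p • (u + a • w) + q • (u + b • w) := by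
      have : u = (p + q) • u := by rw [hpq, one_smul]
      nth_rewrite 1 [this]
      simp only [smul_eq_mul]
      module
    simp only [e]
    exact this
  have h := hc.le_slope_of_hasDerivAt (Set.mem_univ 0) (Set.mem_univ 1) one_pos
    (aux_line f f' hgrad u w 0)
  simp [slope_def_field] at h
  linarith

lemma aux_upper {E : Type*} [NormedAddCommGroup E] [InnerProductSpace ℝ E]
    [FiniteDimensional ℝ E] (f : E → ℝ) (f' : E → E)
    (hgrad : ∀ u, HasGradientAt f (f' u) u) (L : ℝ)
    (hsmooth : ∀ u v, ‖f' u - f' v‖ ≤ L * ‖u - v‖) (u w : E) :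
    f (u + w) ≤ f u + inner ℝ (f' u) w + L / 2 * ‖w‖ ^ 2 := by
  have hd : ∀ t : ℝ, HasDerivAt
      (fun t : ℝ => f (u + t • w) - (t * inner ℝ (f' u) w + t ^ 2 * (L / 2 * ‖w‖ ^ 2)))
      (inner ℝ (f' (u + t • w)) w - (inner ℝ (f' u) w + 2 * t * (L / 2 * ‖w‖ ^ 2))) t := by
    intro t
    have h1 := (hasDerivAt_id t).mul_const (inner ℝ (f' u) w)
    have h2 := (hasDerivAt_pow 2 t).mul_const (L / 2 * ‖w‖ ^ 2)
    have h3 := (aux_line f f' hgrad u w t).sub (h1.add h2)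
    exact h3.congr_deriv (by simp)
  have ha := antitoneOn_of_deriv_nonpos (convex_Icc (0 : ℝ) 1)
    (fun t _ => (hd t).continuousAt.continuousWithinAt)
    (fun t _ => (hd t).differentiableAt.differentiableWithinAt)
    (fun t ht => by
      rw [(hd t).deriv]
      rw [interior_Icc] at ht
      have h1 : inner ℝ (f' (u + t • w)) w - inner ℝ (f' u) w
          = inner ℝ (f' (u + t • w) - f' u) w := by rw [inner_sub_left]
      have h2 := real_inner_le_norm (f' (u + t • w) - f' u) w
      have h3 := hsmooth (u + t • w) u
      rw [add_sub_cancel_left, norm_smul, Real.norm_of_nonneg ht.1.le] at h3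
      have h4 := mul_le_mul_of_nonneg_right h3 (norm_nonneg w)
      nlinarith)
  have := ha (by simp) (by simp) (zero_le_one' ℝ)
  simp at this
  linarith

lemma aux_half {E : Type*} [NormedAddCommGroup E] [InnerProductSpace ℝ E]
    [FiniteDimensional ℝ E] (f : E → ℝ) (f' : E → E)
    (hgrad : ∀ u, HasGradientAt f (f' u) u)
    (hconv : ConvexOn ℝ Set.univ f) (L : ℝ) (hL : 0 < L)
    (hsmooth : ∀ u v, ‖f' u - f' v‖ ≤ L * ‖u - v‖) (u v : E) :
    f u + inner ℝ (f' u) (v - u) + 1 / (2 * L) * ‖f' v - f' u‖ ^ 2 ≤ f v := by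
  have h1 := aux_lower f f' hgrad hconv u ((v - u) + (-(1 / L)) • (f' v - f' u))
  have h2 := aux_upper f f' hgrad L hsmooth v ((-(1 / L)) • (f' v - f' u))
  have e : u + ((v - u) + (-(1 / L)) • (f' v - f' u)) = v + (-(1 / L)) • (f' v - f' u) := by
    abel
  rw [e, inner_add_right, inner_smul_right] at h1
  rw [inner_smul_right, norm_smul, mul_pow, Real.norm_eq_abs, sq_abs] at h2
  have h3 : inner ℝ (f' v) (f' v - f' u) - inner ℝ (f' u) (f' v - f' u)
      = ‖f' v - f' u‖ ^ 2 := by rw [← inner_sub_left, real_inner_self_eq_norm_sq]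
  have h4 : L / 2 * ((-(1 / L)) ^ 2 * ‖f' v - f' u‖ ^ 2)
      = 1 / (2 * L) * ‖f' v - f' u‖ ^ 2 := by field_simp
  have h5 : 1 / L * ‖f' v - f' u‖ ^ 2 = 2 * (1 / (2 * L) * ‖f' v - f' u‖ ^ 2) := by field_simp
  rw [h4] at h2
  rw [← h3, mul_sub] at h5
  rw [h3] at h5
  linarith

/-- Monotone decrease of the gradient norm under a Gradient Descent step
(claim in the proof of Lemma 1). -/
theorem gd_gradient_norm_monotone
    {E : Type*} [NormedAddCommGroup E] [InnerProductSpace ℝ E] [FiniteDimensional ℝ E]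
    (f : E → ℝ) (f' : E → E)
    (hgrad : ∀ u, HasGradientAt f (f' u) u)
    (hconv : ConvexOn ℝ Set.univ f)
    (L : ℝ) (hL : 0 < L)
    (hsmooth : ∀ u v, ‖f' u - f' v‖ ≤ L * ‖u - v‖)
    (γ : ℝ) (hγ : 0 < γ) (hγ2 : γ ≤ 2 / L)
    (x : E) (x' : E) (hx' : x' = x - γ • f' x) :
    ‖f' x'‖ ≤ ‖f' x‖ := by
  have h1 := aux_half f f' hgrad hconv L hL hsmooth x x'
  have h2 := aux_half f f' hgrad hconv L hL hsmooth x' x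
  have e1 : x' - x = (-γ) • f' x := by rw [hx']; module
  have e2 : x - x' = γ • f' x := by rw [hx']; module
  rw [e1, inner_smul_right, norm_sub_rev] at h1
  rw [e2, inner_smul_right] at h2
  have h3 := norm_sub_sq_real (f' x) (f' x')
  have h4 := real_inner_self_eq_norm_sq (f' x)
  have h5 := real_inner_comm (f' x) (f' x')
  have h6 : γ / 2 * ‖f' x - f' x'‖ ^ 2 ≤ 2 * (1 / (2 * L) * ‖f' x - f' x'‖ ^ 2) := by
    have : 2 * (1 / (2 * L) * ‖f' x - f' x'‖ ^ 2) = (2 / L) / 2 * ‖f' x - f' x'‖ ^ 2 := by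
      field_simp
    rw [this]
    gcongr
  have h7 : γ * (‖f' x - f' x'‖ ^ 2 / 2)
      ≤ γ * (inner ℝ (f' x) (f' x) - inner ℝ (f' x') (f' x)) := by
    linarith
  have h8 := le_of_mul_le_mul_left h7 hγ
  refine (sq_le_sq₀ (norm_nonneg _) (norm_nonneg _)).1 ?_
  linarith
end
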